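/- Every multi-player perfect-information game with deterministic transitions, with state and action spaces of arbitrary cardinality, whose payoff functions u_i : P → ℝ are Borel measurable and have finite range, admits a secure equilibrium. -/

import Mathlib

/-- A multi-player perfect-information game with deterministic transitions:
a set of players `N`, a state space `S` (of arbitrary cardinality) with initial
state `init`, a controlling player `ctrl s` and a nonempty action set `act s`
(of arbitrary cardinality) for every state `s`, and a unique successor state
`succ s a` for every state `s` and action `a`.  Every state is reached from the
initial state via exactly one finite history. -/
structure DGame (N S A : Type*) where
  init : S
  ctrl : S → N
  act : S → Set A
  act_nonempty : ∀ s, (act s).Nonempty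
  succ : S → A → S
  unique_pred : ∀ s a s' a', a ∈ act s → a' ∈ act s' →
    succ s a = succ s' a' → s = s' ∧ a = a'
  init_not_succ : ∀ s a, a ∈ act s → succ s a ≠ init
  reach : ∀ z, Relation.ReflTransGen (fun s t => ∃ a ∈ act s, t = succ s a) init z

namespace DGame

variable {N S A : Type*} (G : DGame N S A)

/-- A play: an infinite alternating sequence of states and actions, starting at the
initial state, choosing legal actions and moving to the successor states. -/
def IsPlay (p : ℕ → S × A) : Prop :=
  (p 0).1 = G.init ∧
    ∀ m, (p m).2 ∈ G.act (p m).1 ∧ (p (m + 1)).1 = G.succ (p m).1 (p m).2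

/-- The set of plays of the game. -/
def Play : Type _ := { p : ℕ → S × A // G.IsPlay p }

/-- The set of plays carries the topology generated by the cylinder sets, i.e. the
topology induced by the product of the discrete topologies. -/
instance : TopologicalSpace G.Play :=
  letI : TopologicalSpace S := ⊥
  letI : TopologicalSpace A := ⊥
  inferInstanceAs (TopologicalSpace { p : ℕ → S × A // G.IsPlay p })

/-- The Borel σ-algebra on plays. -/
instance : MeasurableSpace G.Play := borel G.Play

/-- A strategy of player `i`: a choice of a legal action in every state controlled
by `i`. -/
def Strat (i : N) : Type _ := { f : S → A // ∀ s, G.ctrl s = i → f s ∈ G.act s }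

/-- A strategy profile. -/
def Profile : Type _ := ∀ i : N, G.Strat i

/-- The profile `σ` with player `i`'s strategy replaced by `τi`. -/
noncomputable def comb (i : N) (τi : G.Strat i) (σ : G.Profile) : G.Profile :=
  haveI := Classical.decEq N
  Function.update σ i τi

/-- The action that profile `σ` plays in state `s`. -/
def playFun (σ : G.Profile) (s : S) : A := (σ (G.ctrl s)).1 s

/-- The sequence of states visited under the profile `σ`. -/
def stSeq (σ : G.Profile) : ℕ → S := fun n =>
  Nat.rec G.init (fun _ s => G.succ s (G.playFun σ s)) n

/-- The unique play induced by the profile `σ`. -/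
def playOf (σ : G.Profile) : G.Play :=
  ⟨fun n => (G.stSeq σ n, G.playFun σ (G.stSeq σ n)),
    ⟨rfl, fun m => ⟨(σ (G.ctrl (G.stSeq σ m))).2 (G.stSeq σ m) rfl, rfl⟩⟩⟩

/-- Payoff of player `i` under profile `σ`: `u_i(σ) = u_i(p(σ))`. -/
def dpay (u : N → G.Play → ℝ) (σ : G.Profile) (i : N) : ℝ := u i (G.playOf σ)

/-- Nash equilibrium: no player can improve his payoff by a unilateral deviation. -/
def IsNash (u : N → G.Play → ℝ) (σ : G.Profile) : Prop :=
  ∀ (i : N) (τi : G.Strat i), G.dpay u (G.comb i τi σ) i ≤ G.dpay u σ i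

/-- Secure equilibrium: a Nash equilibrium such that no player `i` has a deviation
keeping his own payoff equal, making all opponents weakly worse off, and making
some opponent strictly worse off. -/
def IsSecure (u : N → G.Play → ℝ) (σ : G.Profile) : Prop :=
  G.IsNash u σ ∧
    ¬ ∃ (i : N) (τi : G.Strat i),
        G.dpay u (G.comb i τi σ) i = G.dpay u σ i ∧
        (∀ j : N, j ≠ i → G.dpay u (G.comb i τi σ) j ≤ G.dpay u σ j) ∧
        (∃ k : N, k ≠ i ∧ G.dpay u (G.comb i τi σ) k < G.dpay u σ k)

end DGame

universe v w



/-- A pruned forest with levels. -/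
structure BTree where
  V : Type v
  lev : V → ℕ
  par : V → V
  lev_par : ∀ x, lev (par x) = lev x - 1
  par_root : ∀ x, lev x = 0 → par x = x
  ext : ∀ x, ∃ y, lev y = lev x + 1 ∧ par y = x

namespace BTree

/-- `y` is a child of `x`. -/
def Ch (T : BTree.{v}) (y x : T.V) : Prop := T.lev y = T.lev x + 1 ∧ T.par y = x

/-- Infinite branches. -/
abbrev Play (T : BTree.{v}) : Type v :=
  {x : ℕ → T.V // T.lev (x 0) = 0 ∧ ∀ n, T.Ch (x (n + 1)) (x n)}

/-- Positional choice functions. -/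
abbrev Str (T : BTree.{v}) : Type v := {s : T.V → T.V // ∀ x, T.Ch (s x) x}

/-- Ancestor at level `m`. -/
def anc (T : BTree.{v}) (m : ℕ) (x : T.V) : T.V := T.par^[T.lev x - m] x

variable {T : BTree.{v}}

theorem Play.lev (x : T.Play) (n : ℕ) : T.lev (x.1 n) = n := by
  induction n with
  | zero => exact x.2.1
  | succ n ih => rw [(x.2.2 n).1, ih]

theorem Play.ch (x : T.Play) (n : ℕ) : T.Ch (x.1 (n + 1)) (x.1 n) := x.2.2 n

theorem Play.ext' {x y : T.Play} (h : ∀ n, x.1 n = y.1 n) : x = y :=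
  Subtype.ext (funext h)

theorem anc_of_le {m : ℕ} {x : T.V} (h : T.lev x ≤ m) : T.anc m x = x := by
  simp [anc, Nat.sub_eq_zero_of_le h]

theorem anc_self (x : T.V) : T.anc (T.lev x) x = x := anc_of_le le_rfl

theorem anc_par {m : ℕ} {x : T.V} (h : m < T.lev x) : T.anc m (T.par x) = T.anc m x := by
  unfold anc
  rw [T.lev_par]
  have : T.lev x - m = (T.lev x - 1 - m) + 1 := by omega
  rw [this, Function.iterate_succ_apply]

theorem anc_ch {m : ℕ} {x y : T.V} (hc : T.Ch y x) (h : m ≤ T.lev x) :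
    T.anc m y = T.anc m x := by
  rw [← anc_par (by rw [hc.1]; omega), hc.2]

theorem lev_iter (k : ℕ) (x : T.V) : T.lev (T.par^[k] x) = T.lev x - k := by
  induction k generalizing x with
  | zero => simp
  | succ k ih => rw [Function.iterate_succ_apply, ih, T.lev_par]; omega

theorem lev_anc (m : ℕ) (x : T.V) : T.lev (T.anc m x) = min m (T.lev x) := by
  rw [anc, lev_iter]; omega

theorem anc_anc {m n : ℕ} (h : m ≤ n) (x : T.V) : T.anc m (T.anc n x) = T.anc m x := by
  by_cases hn : T.lev x ≤ n
  · rw [anc_of_le hn]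
  · conv_lhs => rw [anc, lev_anc]
    unfold anc
    rw [← Function.iterate_add_apply]
    congr 1
    omega

theorem par_anc {m : ℕ} {x : T.V} (h : m + 1 ≤ T.lev x) :
    T.par (T.anc (m + 1) x) = T.anc m x := by
  unfold anc
  rw [← Function.iterate_succ_apply' T.par]
  congr 1
  omega

theorem ch_anc {m : ℕ} {x : T.V} (h : m + 1 ≤ T.lev x) :
    T.Ch (T.anc (m + 1) x) (T.anc m x) :=
  ⟨by rw [lev_anc, lev_anc]; omega, par_anc h⟩

theorem Play.anc (x : T.Play) {m n : ℕ} (h : m ≤ n) : T.anc m (x.1 n) = x.1 m := by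
  induction n with
  | zero =>
    obtain rfl : m = 0 := by omega
    exact anc_of_le (x.lev 0).le
  | succ n ih =>
    rcases Nat.lt_or_ge m (n + 1) with h' | h'
    · rw [anc_ch (x.ch n) (by rw [x.lev]; omega), ih (by omega)]
    · obtain rfl : m = n + 1 := by omega
      exact anc_of_le (x.lev _).le

/-- Default child. -/
noncomputable def dft (T : BTree.{v}) (x : T.V) : T.V := (T.ext x).choose

theorem dft_ch (x : T.V) : T.Ch (T.dft x) x := (T.ext x).choose_spec

/-! ### Attractors -/

/-- Ranked attractor. -/
inductive AttrR (T : BTree.{v}) (P : T.V → Prop) (M U : Set T.V) : Ordinal.{v} → T.V → Prop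
  | hit (α : Ordinal.{v}) (x : T.V) (h : x ∈ U) : AttrR T P M U α x
  | mine (α β : Ordinal.{v}) (x y : T.V) (hP : P x) (hc : T.Ch y x) (hM : y ∈ M) (hlt : β < α)
      (h : AttrR T P M U β y) : AttrR T P M U α x
  | theirs (α : Ordinal.{v}) (x : T.V) (g : T.V → Ordinal.{v}) (hP : ¬ P x)
      (hlt : ∀ y, T.Ch y x → y ∈ M → g y < α)
      (h : ∀ y, T.Ch y x → y ∈ M → AttrR T P M U (g y) y) : AttrR T P M U α x

/-- Attractor. -/
def Attr (T : BTree.{v}) (P : T.V → Prop) (M U : Set T.V) : Set T.V :=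
  {x | ∃ α, AttrR T P M U α x}

variable {P : T.V → Prop} {M U : Set T.V}

theorem attr_hit {x : T.V} (h : x ∈ U) : x ∈ T.Attr P M U := ⟨0, AttrR.hit _ _ h⟩

theorem attr_mine {x y : T.V} (hP : P x) (hc : T.Ch y x) (hM : y ∈ M)
    (h : y ∈ T.Attr P M U) : x ∈ T.Attr P M U := by
  obtain ⟨β, hβ⟩ := h
  exact ⟨Order.succ β, AttrR.mine _ β x y hP hc hM (Order.lt_succ β) hβ⟩

theorem attr_theirs {x : T.V} (hP : ¬ P x)
    (h : ∀ y, T.Ch y x → y ∈ M → y ∈ T.Attr P M U) : x ∈ T.Attr P M U := by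
  classical
  let g : T.V → Ordinal.{v} := fun y =>
    if h : ∃ α, AttrR T P M U α y then h.choose else 0
  refine ⟨Order.succ (⨆ y, g y), AttrR.theirs _ x g hP ?_ ?_⟩
  · intro y _ _
    exact Order.lt_succ_of_le (le_ciSup (f := g) (Ordinal.bddAbove_of_small) y)
  · intro y hc hM
    have hy : ∃ α, AttrR T P M U α y := h y hc hM
    simp only [g, dif_pos hy]
    exact hy.choose_spec

theorem attr_strategy (T : BTree.{v}) (P : T.V → Prop) (M U : Set T.V) :
    ∃ f : T.V → T.V, ∃ rk : T.V → Ordinal.{v}, (∀ x, T.Ch (f x) x) ∧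
      ∀ x, x ∈ T.Attr P M U → x ∉ U →
        (P x → f x ∈ M ∧ f x ∈ T.Attr P M U ∧ rk (f x) < rk x) ∧
        (¬ P x → ∀ y, T.Ch y x → y ∈ M → y ∈ T.Attr P M U ∧ rk y < rk x) := by
  classical
  let rk : T.V → Ordinal.{v} := fun x => sInf {α | AttrR T P M U α x}
  have hrk : ∀ x, x ∈ T.Attr P M U → AttrR T P M U (rk x) x := fun x hx => csInf_mem hx
  have hle : ∀ x α, AttrR T P M U α x → rk x ≤ α := fun x α h => csInf_le' h
  let f : T.V → T.V := fun x =>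
    if h : ∃ y, T.Ch y x ∧ y ∈ M ∧ y ∈ T.Attr P M U ∧ rk y < rk x then h.choose else T.dft x
  refine ⟨f, rk, ?_, ?_⟩
  · intro x
    by_cases h : ∃ y, T.Ch y x ∧ y ∈ M ∧ y ∈ T.Attr P M U ∧ rk y < rk x
    · simp only [f, dif_pos h]; exact h.choose_spec.1
    · simp only [f, dif_neg h]; exact dft_ch x
  · intro x hx hU
    have h0 := hrk x hx
    generalize hα : rk x = α at h0
    cases h0 with
    | hit _ _ h => exact absurd h hU
    | mine _ β _ y hP hc hM hlt h =>
      refine ⟨fun _ => ?_, fun h' => absurd hP h'⟩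
      have h : ∃ y, T.Ch y x ∧ y ∈ M ∧ y ∈ T.Attr P M U ∧ rk y < rk x :=
        ⟨y, hc, hM, ⟨β, h⟩, by rw [hα]; exact (hle _ _ h).trans_lt hlt⟩
      rw [← hα]
      simp only [f, dif_pos h]
      exact h.choose_spec.2
    | theirs _ _ g hP hlt h =>
      refine ⟨fun h' => absurd h' hP, fun _ y hc hM => ⟨⟨_, h y hc hM⟩, ?_⟩⟩
      exact (hle _ _ (h y hc hM)).trans_lt (hlt y hc hM)

/-- attractor strategy -/
noncomputable def attrF (T : BTree.{v}) (P : T.V → Prop) (M U : Set T.V) : T.V → T.V :=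
  (attr_strategy T P M U).choose

theorem attrF_ch (x : T.V) : T.Ch (T.attrF P M U x) x :=
  (attr_strategy T P M U).choose_spec.choose_spec.1 x

/-- A play following the attractor strategy reaches the target. -/
theorem attr_reach (x : T.Play) (n : ℕ) (hx : x.1 n ∈ T.Attr P M U) (hM : x.1 n ∈ M)
    (hMc : ∀ m, n ≤ m → x.1 m ∈ M → ¬ P (x.1 m) → x.1 (m + 1) ∈ M)
    (hf : ∀ m, n ≤ m → (∀ j, n ≤ j → j ≤ m → x.1 j ∉ U) → P (x.1 m) →
      x.1 (m + 1) = T.attrF P M U (x.1 m)) :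
    ∃ m, n ≤ m ∧ x.1 m ∈ U := by
  obtain ⟨rk, hch, hst⟩ := (attr_strategy T P M U).choose_spec
  by_contra! hno
  have step : ∀ m, n ≤ m → x.1 m ∈ M → x.1 m ∈ T.Attr P M U →
      x.1 (m + 1) ∈ M ∧ x.1 (m + 1) ∈ T.Attr P M U ∧ rk (x.1 (m + 1)) < rk (x.1 m) := by
    intro m hm h1 h2
    by_cases hp : P (x.1 m)
    · rw [hf m hm (fun j hj _ => hno j hj) hp]
      exact (hst _ h2 (hno m hm)).1 hp
    · have := hMc m hm h1 hp
      exact ⟨this, (hst _ h2 (hno m hm)).2 hp _ (x.ch m) this⟩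
  have inv : ∀ m, x.1 (n + m) ∈ M ∧ x.1 (n + m) ∈ T.Attr P M U := by
    intro m
    induction m with
    | zero => exact ⟨hM, hx⟩
    | succ m ih => exact ⟨(step _ (by omega) ih.1 ih.2).1, (step _ (by omega) ih.1 ih.2).2.1⟩
  have hdec : ∀ m, rk (x.1 (n + (m + 1))) < rk (x.1 (n + m)) := fun m =>
    (step _ (by omega) (inv m).1 (inv m).2).2.2
  exact (RelEmbedding.natGT (r := (· < ·)) (fun m => rk (x.1 (n + m))) hdec).not_wellFounded
    Ordinal.lt_wf

/-- Some ancestor of level at least `L` is in `U`. -/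
def HasU (T : BTree.{v}) (L : ℕ) (U : Set T.V) (x : T.V) : Prop :=
  ∃ m, L ≤ m ∧ m ≤ T.lev x ∧ T.anc m x ∈ U

open Classical in
/-- The first ancestor of level at least `L` in `U`. -/
noncomputable def firstU (T : BTree.{v}) (L : ℕ) (U : Set T.V) (x : T.V) : T.V :=
  if h : T.HasU L U x then T.anc (Nat.find h) x else x

open Classical in
/-- Combined steering strategy. -/
noncomputable def steer (T : BTree.{v}) (P : T.V → Prop) (M U : Set T.V) (L : ℕ)
    (Safe : T.V → Prop) (g0 g1 : T.V → T.V) (x : T.V) : T.V :=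
  if Safe x then g0 x else if T.HasU L U x then g1 x else T.attrF P M U x

theorem steer_ch {L : ℕ} {Safe : T.V → Prop} {g0 g1 : T.V → T.V}
    (h0 : ∀ x, T.Ch (g0 x) x) (h1 : ∀ x, T.Ch (g1 x) x) (x : T.V) :
    T.Ch (T.steer P M U L Safe g0 g1 x) x := by
  unfold steer
  split_ifs
  · exact h0 x
  · exact h1 x
  · exact attrF_ch x

theorem steer_congr {L : ℕ} {Safe : T.V → Prop} {g0 g1 g0' g1' : T.V → T.V} (x : T.V)
    (h0 : g0 x = g0' x) (h1 : g1 x = g1' x) :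
    T.steer P M U L Safe g0 g1 x = T.steer P M U L Safe g0' g1' x := by
  unfold steer
  rw [h0, h1]

theorem steer_spec {L : ℕ} {Safe : T.V → Prop} {g0 g1 : T.V → T.V} (x : T.Play)
    (hcons : ∀ n, L ≤ n → P (x.1 n) → x.1 (n + 1) = T.steer P M U L Safe g0 g1 (x.1 n))
    (hstart : Safe (x.1 L) ∨ (x.1 L ∈ M ∧ x.1 L ∈ T.Attr P M U))
    (hMc : ∀ n, L ≤ n → x.1 n ∈ M → ¬ P (x.1 n) → x.1 (n + 1) ∈ M)
    (hs1 : ∀ n, L ≤ n → Safe (x.1 n) → P (x.1 n) → Safe (g0 (x.1 n)))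
    (hs2 : ∀ n, L ≤ n → Safe (x.1 n) → ¬ P (x.1 n) →
      Safe (x.1 (n + 1)) ∨ (x.1 (n + 1) ∈ M ∧ x.1 (n + 1) ∈ T.Attr P M U))
    (hs3 : ∀ n, L ≤ n → Safe (x.1 n) → x.1 n ∉ U)
    (hs4 : ∀ n, L ≤ n → Safe (x.1 (n + 1)) → Safe (x.1 n)) :
    (∀ n, L ≤ n → Safe (x.1 n) ∧ (P (x.1 n) → x.1 (n + 1) = g0 (x.1 n))) ∨
    (∃ m, L ≤ m ∧ x.1 m ∈ U ∧ ∀ n, m ≤ n → T.firstU L U (x.1 n) = x.1 m ∧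
      (P (x.1 n) → x.1 (n + 1) = g1 (x.1 n))) := by
  classical
  have hHas : ∀ n, T.HasU L U (x.1 n) ↔ ∃ m, L ≤ m ∧ m ≤ n ∧ x.1 m ∈ U := by
    intro n
    constructor
    · rintro ⟨m, h1, h2, h3⟩
      rw [x.lev] at h2
      rw [x.anc h2] at h3
      exact ⟨m, h1, h2, h3⟩
    · rintro ⟨m, h1, h2, h3⟩
      exact ⟨m, h1, by rwa [x.lev], by rwa [x.anc h2]⟩
  by_cases hall : ∀ n, L ≤ n → Safe (x.1 n)
  · left
    intro n hn
    refine ⟨hall n hn, fun hp => ?_⟩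
    rw [hcons n hn hp, steer, if_pos (hall n hn)]
  · right
    push Not at hall
    have hn0 := Nat.find_spec hall
    have hmin : ∀ m, m < Nat.find hall → L ≤ m → Safe (x.1 m) := fun m hm hL => by
      have := Nat.find_min hall hm
      by_contra hc
      exact this ⟨hL, hc⟩
    generalize Nat.find hall = n0 at hn0 hmin
    obtain ⟨hL0, hns⟩ := hn0
    have huns : ∀ n, n0 ≤ n → ¬ Safe (x.1 n) := by
      intro n hn
      induction n, hn using Nat.le_induction with
      | base => exact hns
      | succ n hn ih =>
        exact fun h => ih (hs4 n (by omega) h)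
    have hAt : x.1 n0 ∈ M ∧ x.1 n0 ∈ T.Attr P M U := by
      rcases Nat.eq_or_lt_of_le hL0 with h | h
      · subst h
        exact hstart.resolve_left hns
      · obtain ⟨j, rfl⟩ : ∃ j, n0 = j + 1 := ⟨n0 - 1, by omega⟩
        have hsj := hmin j (by omega) (by omega)
        by_cases hp : P (x.1 j)
        · exfalso
          apply hns
          rw [hcons j (by omega) hp, steer, if_pos hsj]
          exact hs1 j (by omega) hsj hp
        · exact (hs2 j (by omega) hsj hp).resolve_left hns
    have hnoU : ∀ m, L ≤ m → m < n0 → x.1 m ∉ U := fun m hm hmn hU =>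
      hs3 m hm (hmin m hmn hm) hU
    have hhit : ∃ m, n0 ≤ m ∧ x.1 m ∈ U := by
      apply attr_reach x n0 hAt.2 hAt.1
      · exact fun m hm => hMc m (by omega)
      · intro m hm hj hp
        rw [hcons m (by omega) hp, steer, if_neg (huns m hm), if_neg]
        rw [hHas]
        rintro ⟨j, h1, h2, h3⟩
        by_cases hjn : n0 ≤ j
        · exact hj j hjn h2 h3
        · exact hnoU j h1 (by omega) h3
    have hm := Nat.find_spec hhit
    have hmmin : ∀ m, m < Nat.find hhit → n0 ≤ m → x.1 m ∉ U := fun m hm h h' =>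
      Nat.find_min hhit hm ⟨h, h'⟩
    generalize Nat.find hhit = m at hm hmmin
    have hfirst : ∀ j, L ≤ j → j < m → x.1 j ∉ U := by
      intro j h1 h2
      by_cases hjn : n0 ≤ j
      · exact hmmin j h2 hjn
      · exact hnoU j h1 (by omega)
    refine ⟨m, by omega, hm.2, fun n hn => ?_⟩
    have hH : T.HasU L U (x.1 n) := (hHas n).2 ⟨m, by omega, hn, hm.2⟩
    constructor
    · rw [firstU, dif_pos hH]
      have : Nat.find hH = m := by
        refine (Nat.find_eq_iff hH).2 ?_
        refine ⟨⟨by omega, by rwa [x.lev], by rw [x.anc hn]; exact hm.2⟩, ?_⟩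
        rintro j hj ⟨h1, h2, h3⟩
        rw [x.lev] at h2
        rw [x.anc h2] at h3
        exact hfirst j h1 hj h3
      rw [this, x.anc hn]
    · intro hp
      rw [hcons n (by omega) hp, steer, if_neg (huns n (by omega)), if_pos hH]

/-! ### Players and coverings -/

/-- Player `true` moves at even levels, player `false` at odd levels. -/
def turn (b : Bool) (n : ℕ) : Prop := if b then n % 2 = 0 else n % 2 = 1

/-- Play consistent with a strategy. -/
def Cons (b : Bool) (s : T.Str) (x : T.Play) : Prop :=
  ∀ n, turn b n → x.1 (n + 1) = s.1 (x.1 n)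

end BTree

open BTree

/-- A covering which is an isomorphism up to level `k`. -/
structure BCover (k : ℕ) (T : BTree.{v}) where
  T' : BTree.{v}
  pr : T'.V → T.V
  lev_pr : ∀ x, T.lev (pr x) = T'.lev x
  par_pr : ∀ x, pr (T'.par x) = T.par (pr x)
  phi : Bool → T'.Str → T.Str
  loc : ∀ b n (s t : T'.Str), (∀ x, T'.lev x < n → s.1 x = t.1 x) →
    ∀ x, T.lev x < n → (phi b s).1 x = (phi b t).1 x
  inj : ∀ x y, T'.lev x ≤ k → pr x = pr y → x = y
  surj : ∀ x, T.lev x ≤ k → ∃ y, pr y = x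
  same : ∀ b s x, T'.lev x < k → pr (s.1 x) = (phi b s).1 (pr x)
  lift : ∀ b s (x : T.Play), Cons b (phi b s) x →
    ∃ y : T'.Play, Cons b s y ∧ ∀ n, pr (y.1 n) = x.1 n

namespace BCover

variable {k : ℕ} {T : BTree.{v}}

theorem ch_pr (c : BCover k T) {y x : c.T'.V} (h : c.T'.Ch y x) : T.Ch (c.pr y) (c.pr x) :=
  ⟨by rw [c.lev_pr, c.lev_pr, h.1], by rw [← c.par_pr, h.2]⟩

/-- Projection of plays. -/
def map (c : BCover k T) (x : c.T'.Play) : T.Play :=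
  ⟨fun n => c.pr (x.1 n), by rw [c.lev_pr]; exact x.2.1, fun n => c.ch_pr (x.ch n)⟩

/-- weaken level -/
def weaken (c : BCover k T) {j : ℕ} (h : j ≤ k) : BCover j T :=
  { T' := c.T', pr := c.pr, lev_pr := c.lev_pr, par_pr := c.par_pr, phi := c.phi, loc := c.loc
    inj := fun x y hx => c.inj x y (hx.trans h)
    surj := fun x hx => c.surj x (hx.trans h)
    same := fun b s x hx => c.same b s x (hx.trans_le h)
    lift := c.lift }

/-- composition -/
def comp (c : BCover k T) (d : BCover k c.T') : BCover k T :=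
  { T' := d.T', pr := fun x => c.pr (d.pr x)
    lev_pr := fun x => by rw [c.lev_pr, d.lev_pr]
    par_pr := fun x => by rw [d.par_pr, c.par_pr]
    phi := fun b s => c.phi b (d.phi b s)
    loc := fun b n s t h => c.loc b n _ _ (d.loc b n s t h)
    inj := fun x y hx h => d.inj x y hx (c.inj _ _ (by rwa [d.lev_pr]) h)
    surj := fun x hx => by
      obtain ⟨y, rfl⟩ := c.surj x hx
      obtain ⟨z, rfl⟩ := d.surj y (by rwa [← c.lev_pr])
      exact ⟨z, rfl⟩
    same := fun b s x hx => by
      rw [d.same b s x hx |> congrArg c.pr]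
      exact c.same b _ _ (by rwa [d.lev_pr])
    lift := fun b s x hx => by
      obtain ⟨y, hy, hyx⟩ := c.lift b _ x hx
      obtain ⟨z, hz, hzy⟩ := d.lift b s y hy
      exact ⟨z, hz, fun n => by rw [hzy, hyx]⟩ }

end BCover

/-- A set of plays decided at a finite level. -/
def BDec {T : BTree.{v}} (B : Set T.Play) : Prop :=
  ∃ (n : ℕ) (D : Set T.V), ∀ x : T.Play, x ∈ B ↔ x.1 n ∈ D

/-- Open sets of plays. -/
def BOpen {T : BTree.{v}} (B : Set T.Play) : Prop :=
  ∀ x ∈ B, ∃ n, ∀ y : T.Play, y.1 n = x.1 n → y ∈ B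


/-! ### Inverse limits of coverings -/

/-- A sequence of coverings. -/
structure BSeq where
  k : ℕ
  T : ℕ → BTree.{v}
  pr : ∀ i, (T (i + 1)).V → (T i).V
  lev_pr : ∀ i x, (T i).lev (pr i x) = (T (i + 1)).lev x
  par_pr : ∀ i x, pr i ((T (i + 1)).par x) = (T i).par (pr i x)
  phi : ∀ i, Bool → (T (i + 1)).Str → (T i).Str
  loc : ∀ i b n (s t : (T (i + 1)).Str), (∀ x, (T (i + 1)).lev x < n → s.1 x = t.1 x) →
    ∀ x, (T i).lev x < n → (phi i b s).1 x = (phi i b t).1 x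
  inj : ∀ i x y, (T (i + 1)).lev x ≤ k + i → pr i x = pr i y → x = y
  surj : ∀ i x, (T i).lev x ≤ k + i → ∃ y, pr i y = x
  same : ∀ i b s x, (T (i + 1)).lev x < k + i → pr i (s.1 x) = (phi i b s).1 (pr i x)
  lift : ∀ i b s (x : (T i).Play), Cons b (phi i b s) x →
    ∃ y : (T (i + 1)).Play, Cons b s y ∧ ∀ n, pr i (y.1 n) = x.1 n

namespace BSeq

variable (Q : BSeq.{v})

/-- Vertices of the limit. -/
abbrev LV : Type v := {f : ∀ i, (Q.T i).V // ∀ i, Q.pr i (f (i + 1)) = f i}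

variable {Q}

theorem lev_const (f : Q.LV) (i : ℕ) : (Q.T i).lev (f.1 i) = (Q.T 0).lev (f.1 0) := by
  induction i with
  | zero => rfl
  | succ i ih => rw [← Q.lev_pr, f.2, ih]

theorem lev_const' (f : Q.LV) (i j : ℕ) : (Q.T i).lev (f.1 i) = (Q.T j).lev (f.1 j) := by
  rw [lev_const, ← lev_const f j]

theorem LV.eq_of (f g : Q.LV) (i : ℕ) (hl : (Q.T i).lev (f.1 i) ≤ Q.k + i)
    (h : f.1 i = g.1 i) : f = g := by
  have down : ∀ d j, j + d = i → f.1 j = g.1 j := by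
    intro d
    induction d with
    | zero => rintro j rfl; exact h
    | succ d ih =>
      intro j hj
      rw [← f.2, ← g.2, ih (j + 1) (by omega)]
  have up : ∀ d, f.1 (i + d) = g.1 (i + d) := by
    intro d
    induction d with
    | zero => exact h
    | succ d ih =>
      apply Q.inj (i + d)
      · have := lev_const' f (i + d + 1) i
        exact this.trans_le (by omega)
      · have h1 := f.2 (i + d)
        have h2 := g.2 (i + d)
        exact h1.trans (ih.trans h2.symm)
  apply Subtype.ext
  funext j
  rcases Nat.le_total j i with hj | hj
  · exact down (i - j) j (by omega)
  · obtain ⟨d, rfl⟩ := Nat.exists_eq_add_of_le hj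
    exact up d

/-- up map -/
noncomputable def up (Q : BSeq.{v}) (i : ℕ) (x : (Q.T i).V) (h : (Q.T i).lev x ≤ Q.k + i) :
    {y : (Q.T (i + 1)).V // Q.pr i y = x} := ⟨(Q.surj i x h).choose, (Q.surj i x h).choose_spec⟩

theorem exists_down (Q : BSeq.{v}) (i : ℕ) (x : (Q.T i).V) :
    ∃ g : ∀ j, (Q.T j).V, g i = x ∧ ∀ j, j < i → Q.pr j (g (j + 1)) = g j := by
  classical
  induction i with
  | zero => 
    exact ⟨fun j => if h : j = 0 then h ▸ x else (Classical.choice ⟨by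
      have hne : ∀ j, Nonempty (Q.T j).V := by
        intro j
        induction j with
        | zero => exact ⟨x⟩
        | succ j ih =>
          obtain ⟨y⟩ := ih
          have hr : ∀ n, ∃ z : (Q.T j).V, (Q.T j).lev z = (Q.T j).lev y - n := by
            intro n
            exact ⟨_, lev_iter n y⟩
          obtain ⟨z, hz⟩ := hr ((Q.T j).lev y)
          obtain ⟨w, _⟩ := Q.surj j z (by omega)
          exact ⟨w⟩
      exact Classical.choice (hne j)⟩), by simp, by simp⟩
  | succ i ih =>
    obtain ⟨g, hg, hg'⟩ := ih (Q.pr i x)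
    refine ⟨Function.update g (i + 1) x, by simp, fun j hj => ?_⟩
    rw [Function.update_of_ne (by omega : j ≠ i + 1)]
    by_cases h : j = i
    · subst h
      simp [hg]
    · rw [Function.update_of_ne (by omega)]
      exact hg' j (by omega)

theorem exists_LV (i : ℕ) (x : (Q.T i).V) (h : (Q.T i).lev x ≤ Q.k + i) :
    ∃ f : Q.LV, f.1 i = x := by
  classical
  obtain ⟨g, hg, hg'⟩ := exists_down Q i x
  -- extend upwards
  have key : ∀ d, ∃ g : ∀ j, (Q.T j).V, g i = x ∧ ∀ j, j < i + d → Q.pr j (g (j + 1)) = g j := by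
    intro d
    induction d with
    | zero => exact ⟨g, hg, hg'⟩
    | succ d ih =>
      obtain ⟨g, hg, hg'⟩ := ih
      have hlev : ∀ e, e ≤ d → (Q.T (i + e)).lev (g (i + e)) = (Q.T i).lev x := by
        intro e he
        induction e with
        | zero => rw [← hg]; rfl
        | succ e ih =>
          rw [← ih (by omega), ← hg' (i + e) (by omega), Q.lev_pr]; rfl
      obtain ⟨y, hy⟩ := Q.surj (i + d) (g (i + d)) (by rw [hlev d le_rfl]; omega)
      refine ⟨Function.update g (i + d + 1) y, ?_, ?_⟩
      · rw [Function.update_of_ne (by omega), hg]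
      · intro j hj
        rw [Function.update_of_ne (by omega : j ≠ i + d + 1)]
        by_cases h : j = i + d
        · subst h; simp [hy]
        · rw [Function.update_of_ne (by omega)]
          exact hg' j (by omega)
  choose G hG hG' using key
  have hlevG : ∀ d e, e ≤ d → (Q.T (i + e)).lev (G d (i + e)) = (Q.T i).lev x := by
    intro d e he
    induction e with
    | zero => rw [← hG d]; rfl
    | succ e ih =>
      rw [← ih (by omega), ← hG' d (i + e) (by omega), Q.lev_pr]; rfl
  have hup : ∀ d d' e, e ≤ d → e ≤ d' → G d (i + e) = G d' (i + e) := by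
    intro d d' e h1 h2
    induction e with
    | zero => rw [show i + 0 = i from rfl, hG, hG]
    | succ e ih =>
      have ih := ih (by omega) (by omega)
      apply Q.inj (i + e)
      · have := hlevG d (e + 1) h1
        exact this.trans_le (by omega)
      · have a1 := hG' d (i + e) (by omega)
        have a2 := hG' d' (i + e) (by omega)
        exact a1.trans (ih.trans a2.symm)
  have hdown : ∀ d d' c j, j + c = i → G d j = G d' j := by
    intro d d' c
    induction c with
    | zero => rintro j rfl; exact (hG d).trans (hG d').symm
    | succ c ih =>
      intro j hj
      rw [← hG' d j (by omega), ← hG' d' j (by omega), ih (j + 1) (by omega)]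
  have hall : ∀ d d' j, j ≤ i + d → j ≤ i + d' → G d j = G d' j := by
    intro d d' j h1 h2
    rcases Nat.le_total j i with hj | hj
    · exact hdown d d' (i - j) j (by omega)
    · obtain ⟨e, rfl⟩ := Nat.exists_eq_add_of_le hj
      exact hup d d' e (by omega) (by omega)
  refine ⟨⟨fun j => G j j, fun j => ?_⟩, ?_⟩
  · rw [hG' (j + 1) j (by omega)]
    exact hall _ _ _ (by omega) (by omega)
  · exact hG i

/-- The limit tree. -/
def lim (Q : BSeq.{v}) : BTree.{v} :=
  { V := Q.LV
    lev := fun f => (Q.T 0).lev (f.1 0)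
    par := fun f => ⟨fun i => (Q.T i).par (f.1 i), fun i => by rw [Q.par_pr, f.2]⟩
    lev_par := fun f => (Q.T 0).lev_par _
    par_root := fun f hf => Subtype.ext (funext fun i =>
      (Q.T i).par_root _ (by rw [lev_const]; exact hf))
    ext := fun f => by
      let i := (Q.T 0).lev (f.1 0) + 1
      obtain ⟨y, hy, hyp⟩ := (Q.T i).ext (f.1 i)
      rw [lev_const] at hy
      obtain ⟨g, hg⟩ := exists_LV i y (by rw [hy]; omega)
      refine ⟨g, ?_, ?_⟩
      · rw [← lev_const g i, hg, hy]
      · apply LV.eq_of _ _ i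
        · change (Q.T i).lev ((Q.T i).par (g.1 i)) ≤ _
          rw [(Q.T i).lev_par, hg, hy]; omega
        · change (Q.T i).par (g.1 i) = _
          rw [hg, hyp] }

theorem lim_lev (f : Q.lim.V) (i : ℕ) : (Q.T i).lev (f.1 i) = Q.lim.lev f := lev_const f i

theorem lim_ch {f g : Q.lim.V} (h : Q.lim.Ch f g) (i : ℕ) : (Q.T i).Ch (f.1 i) (g.1 i) := by
  refine ⟨by rw [lim_lev, lim_lev, h.1], ?_⟩
  rw [← h.2]; rfl

/-- Evaluation of a play of the limit. -/
def ev (Q : BSeq.{v}) (i : ℕ) (x : Q.lim.Play) : (Q.T i).Play :=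
  ⟨fun n => (x.1 n).1 i, by rw [lim_lev]; exact x.2.1, fun n => lim_ch (x.ch n) i⟩

open Classical in
/-- Truncated strategies. -/
noncomputable def tau (Q : BSeq.{v}) (s : Q.lim.Str) (j : ℕ) : (Q.T j).Str :=
  ⟨fun w => if h : (Q.T j).lev w ≤ Q.k + j then
      (s.1 (exists_LV j w h).choose).1 j else (Q.T j).dft w, fun w => by
    dsimp only
    split_ifs with h
    · have := lim_ch (s.2 (exists_LV j w h).choose) j
      rwa [(exists_LV j w h).choose_spec] at this
    · exact dft_ch w⟩

theorem tau_spec (s : Q.lim.Str) (j : ℕ) (f : Q.lim.V) (h : Q.lim.lev f ≤ Q.k + j) :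
    (tau Q s j).1 (f.1 j) = (s.1 f).1 j := by
  have h' : (Q.T j).lev (f.1 j) ≤ Q.k + j := by rwa [lim_lev]
  have e : (exists_LV j (f.1 j) h').choose = f := by
    have := (exists_LV j (f.1 j) h').choose_spec
    exact LV.eq_of _ _ j (by rw [this]; exact h') this
  simp only [tau, dif_pos h', e]

theorem tau_loc (s t : Q.lim.Str) (n : ℕ) (h : ∀ x, Q.lim.lev x < n → s.1 x = t.1 x) (j : ℕ)
    (x : (Q.T j).V) (hx : (Q.T j).lev x < n) : (tau Q s j).1 x = (tau Q t j).1 x := by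
  simp only [tau]
  split_ifs with h'
  · have := (exists_LV j x h').choose_spec
    have e := h (exists_LV j x h').choose (by
      refine lt_of_eq_of_lt ?_ hx
      exact (lim_lev (exists_LV j x h').choose j).symm.trans (congrArg (Q.T j).lev this))
    exact congrArg (fun f : Q.LV => f.1 j) e
  · rfl

/-- Iterated images. -/
noncomputable def rho (Q : BSeq.{v}) (b : Bool) (s : Q.lim.Str) : ℕ → ∀ i, (Q.T i).Str
  | 0, i => tau Q s i
  | d + 1, i => Q.phi i b (rho Q b s d (i + 1))

theorem rho_loc (b : Bool) (s t : Q.lim.Str) (n : ℕ) (h : ∀ x, Q.lim.lev x < n → s.1 x = t.1 x)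
    (d i : ℕ) : ∀ x : (Q.T i).V, (Q.T i).lev x < n →
      (rho Q b s d i).1 x = (rho Q b t d i).1 x := by
  induction d generalizing i with
  | zero => exact tau_loc s t n h i
  | succ d ih => exact Q.loc i b n _ _ (ih (i + 1))

theorem rho_step (b : Bool) (s : Q.lim.Str) (d i : ℕ) : ∀ x : (Q.T i).V,
    (Q.T i).lev x < Q.k + i + d → (rho Q b s (d + 1) i).1 x = (rho Q b s d i).1 x := by
  induction d generalizing i with
  | zero =>
    intro x hx
    obtain ⟨f, rfl⟩ := exists_LV (Q := Q) i x (by omega)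
    have hl : Q.lim.lev f ≤ Q.k + i := by rw [← lim_lev f i]; omega
    change (Q.phi i b (tau Q s (i + 1))).1 (f.1 i) = (tau Q s i).1 (f.1 i)
    rw [tau_spec s i f hl]
    have h1 := Q.same i b (tau Q s (i + 1)) (f.1 (i + 1)) (by
      have := lev_const' f (i + 1) i
      rw [this]; omega)
    rw [f.2] at h1
    rw [← h1, tau_spec s (i + 1) f (by omega)]
    exact (s.1 f).2 i
  | succ d ih =>
    exact Q.loc i b _ _ _ (fun x hx => ih (i + 1) x (by omega))

theorem rho_eq (b : Bool) (s : Q.lim.Str) (d e i : ℕ) (x : (Q.T i).V)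
    (hx : (Q.T i).lev x < Q.k + i + d) : (rho Q b s (d + e) i).1 x = (rho Q b s d i).1 x := by
  induction e with
  | zero => rfl
  | succ e ih => rw [← ih]; exact rho_step b s (d + e) i x (by omega)

/-- Limit strategies. -/
noncomputable def sig (Q : BSeq.{v}) (b : Bool) (s : Q.lim.Str) (i : ℕ) : (Q.T i).Str :=
  ⟨fun x => (rho Q b s ((Q.T i).lev x + 1) i).1 x, fun x => (rho Q b s _ i).2 x⟩

theorem sig_eq (b : Bool) (s : Q.lim.Str) (i d : ℕ) (x : (Q.T i).V) (hd : (Q.T i).lev x < d) :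
    (sig Q b s i).1 x = (rho Q b s d i).1 x := by
  obtain ⟨e, rfl⟩ := Nat.exists_eq_add_of_le (show (Q.T i).lev x + 1 ≤ d by omega)
  exact (rho_eq b s _ e i x (by omega)).symm

theorem sig_tau (b : Bool) (s : Q.lim.Str) (i : ℕ) (x : (Q.T i).V)
    (hx : (Q.T i).lev x < Q.k + i) : (sig Q b s i).1 x = (tau Q s i).1 x := by
  have := rho_eq b s 0 ((Q.T i).lev x + 1) i x (by omega)
  rw [zero_add] at this
  exact this

theorem phi_sig (b : Bool) (s : Q.lim.Str) (i : ℕ) :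
    Q.phi i b (sig Q b s (i + 1)) = sig Q b s i := by
  apply Subtype.ext
  funext x
  rw [sig_eq b s i ((Q.T i).lev x + 1 + 1) x (by omega)]
  exact Q.loc i b ((Q.T i).lev x + 1) _ _
    (fun y hy => sig_eq b s (i + 1) _ y hy) x (by omega)

/-- The limit covering. -/
noncomputable def limCover (Q : BSeq.{v}) : BCover Q.k (Q.T 0) :=
  { T' := Q.lim
    pr := fun f => f.1 0
    lev_pr := fun f => rfl
    par_pr := fun f => rfl
    phi := fun b s => sig Q b s 0
    loc := fun b n s t h x hx => rho_loc b s t n h _ 0 x hx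
    inj := fun x y hx h => LV.eq_of x y 0 hx h
    surj := fun x hx => exists_LV 0 x hx
    same := fun b s x hx => by
      rw [sig_tau b s 0 _ hx]
      exact (tau_spec s 0 x hx.le).symm
    lift := fun b s x hx => by
      let Y : ∀ i, {y : (Q.T i).Play // Cons b (sig Q b s i) y} := fun i =>
        Nat.rec (motive := fun i => {y : (Q.T i).Play // Cons b (sig Q b s i) y}) ⟨x, hx⟩
          (fun i y => ⟨(Q.lift i b (sig Q b s (i + 1)) y.1
            (by rw [phi_sig]; exact y.2)).choose,
            (Q.lift i b (sig Q b s (i + 1)) y.1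
            (by rw [phi_sig]; exact y.2)).choose_spec.1⟩) i
      have hY : ∀ i n, Q.pr i ((Y (i + 1)).1.1 n) = (Y i).1.1 n := fun i =>
        (Q.lift i b (sig Q b s (i + 1)) (Y i).1
            (by rw [phi_sig]; exact (Y i).2)).choose_spec.2
      let z : Q.lim.Play := ⟨fun n => ⟨fun i => (Y i).1.1 n, fun i => hY i n⟩,
        x.2.1, fun n => ⟨(x.2.2 n).1, Subtype.ext (funext fun i => ((Y i).1.2.2 n).2)⟩⟩
      refine ⟨z, fun n hn => ?_, fun n => rfl⟩
      apply LV.eq_of _ _ (n + 1)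
      · rw [lev_const]
        have := z.lev (n + 1)
        change Q.lim.lev (z.1 (n + 1)) ≤ _
        rw [this]; omega
      · change (Y (n + 1)).1.1 (n + 1) = _
        rw [(Y (n + 1)).2 n hn, sig_tau]
        · exact tau_spec s (n + 1) (z.1 n) (by rw [z.lev]; omega)
        · rw [Play.lev]; omega }

end BSeq


/-! ### Unraveling closed sets -/

namespace BUnr

variable {T : BTree.{v}} (K : ℕ) (A : Set T.Play)

/-- No play through `w` is in `A`. -/
def Out (w : T.V) : Prop := ∀ x : T.Play, x.1 (T.lev w) = w → x ∉ A

/-- Vertices comparable with `u`. -/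
def Cone (u : T.V) : Set T.V := {w | T.anc (T.lev w) u = w ∨ T.anc (T.lev u) w = u}

/-- Quasi-strategies of the first player. -/
def QI (a : T.V) (S : Set T.V) : Prop :=
  a ∈ S ∧ ∀ w ∈ S, K + 1 ≤ T.lev w → (T.lev w % 2 = 0 → ∃ c, T.Ch c w ∧ c ∈ S) ∧
    (T.lev w % 2 = 1 → ∀ c, T.Ch c w → c ∈ S)

/-- Second player's acceptance. -/
def QC2 (b : T.V) (S C : Set T.V) : Prop :=
  b ∈ C ∧ C ⊆ S ∧ (∀ w ∈ C, ¬ Out A w) ∧ ∀ w ∈ C, K + 2 ≤ T.lev w →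
    (T.lev w % 2 = 1 → ∃ c, T.Ch c w ∧ c ∈ C) ∧
    (T.lev w % 2 = 0 → ∀ c, T.Ch c w → c ∈ S → c ∈ C)

/-- Second player's challenge. -/
def QC1 (b : T.V) (S C : Set T.V) : Prop :=
  ∃ u ∈ S, K + 2 ≤ T.lev u ∧ T.anc (K + 2) u = b ∧ Out A u ∧ C = Cone u

/-- Validity of the auxiliary data. -/
structure Val (x : T.V) (S C : Set T.V) (fl : Bool) : Prop where
  s0 : T.lev x ≤ K → S = Set.univ
  s1 : K + 1 ≤ T.lev x → QI K (T.anc (K + 1) x) S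
  c0 : T.lev x ≤ K + 1 → C = Set.univ
  f0 : T.lev x ≤ K + 1 → fl = false
  c1 : K + 2 ≤ T.lev x → fl = false → QC1 K A (T.anc (K + 2) x) S C
  c2 : K + 2 ≤ T.lev x → fl = true → QC2 K A (T.anc (K + 2) x) S C
  c3 : ∀ m, K + 2 ≤ m → m ≤ T.lev x → T.anc m x ∈ C

/-- Vertices of the unraveled tree. -/
structure UNode where
  x : T.V
  S : Set T.V
  C : Set T.V
  fl : Bool
  val : Val K A x S C fl

variable {K A}

theorem UNode.ext' {y z : UNode K A} (h1 : y.x = z.x) (h2 : y.S = z.S) (h3 : y.C = z.C)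
    (h4 : y.fl = z.fl) : y = z := by
  cases y; cases z; simp_all

/-- parent -/
def upar (y : UNode K A) : UNode K A :=
  { x := T.par y.x
    S := if T.lev y.x ≤ K + 1 then Set.univ else y.S
    C := if T.lev y.x ≤ K + 2 then Set.univ else y.C
    fl := if T.lev y.x ≤ K + 2 then false else y.fl
    val := by
      have hl := T.lev_par y.x
      constructor
      · intro h; rw [if_pos (by omega)]
      · intro h
        rw [if_neg (by omega), anc_par (by omega)]
        exact y.val.s1 (by omega)
      · intro h; rw [if_pos (by omega)]
      · intro h; rw [if_pos (by omega)]
      · intro h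
        rw [if_neg (by omega), if_neg (by omega), if_neg (by omega), anc_par (by omega)]
        exact y.val.c1 (by omega)
      · intro h
        rw [if_neg (by omega), if_neg (by omega), if_neg (by omega), anc_par (by omega)]
        exact y.val.c2 (by omega)
      · intro m h1 h2
        rw [if_neg (by omega), anc_par (by omega)]
        exact y.val.c3 m h1 (by omega) }

theorem anc_mem_cone (u : T.V) (m : ℕ) : T.anc m u ∈ Cone u := by
  by_cases h : T.lev u ≤ m
  · rw [anc_of_le h]; left; exact anc_self u
  · left
    rw [lev_anc, min_eq_left (by omega)]

theorem cone_of_anc {u w : T.V} (h : T.anc (T.lev u) w = u) : w ∈ Cone u := Or.inr h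

theorem cone_low {u w : T.V} (h : w ∈ Cone u) (hl : T.lev w ≤ T.lev u) :
    T.anc (T.lev w) u = w := by
  rcases h with h | h
  · exact h
  · rw [anc_of_le hl] at h
    subst h
    exact anc_self w

theorem cone_high {u w : T.V} (h : w ∈ Cone u) (hl : T.lev u ≤ T.lev w) :
    T.anc (T.lev u) w = u := by
  rcases h with h | h
  · rw [anc_of_le hl] at h
    subst h
    exact anc_self u
  · exact h

theorem upar_ext (hK : K % 2 = 0) (y : UNode K A) :
    ∃ z : UNode K A, T.lev z.x = T.lev y.x + 1 ∧ upar z = y := by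
  classical
  have mk : ∀ (w : T.V) (S C : Set T.V) (fl : Bool), T.Ch w y.x → Val K A w S C fl →
      (K + 1 ≤ T.lev y.x → S = y.S) → (K + 2 ≤ T.lev y.x → C = y.C ∧ fl = y.fl) →
      ∃ z : UNode K A, T.lev z.x = T.lev y.x + 1 ∧ upar z = y := by
    intro w S C fl hc hv hS hC
    refine ⟨⟨w, S, C, fl, hv⟩, hc.1, ?_⟩
    have h1 := hc.1
    apply UNode.ext'
    · exact hc.2
    · simp only [upar]
      split_ifs with h
      · exact (y.val.s0 (by omega)).symm
      · exact hS (by omega)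
    · simp only [upar]
      split_ifs with h
      · exact (y.val.c0 (by omega)).symm
      · exact (hC (by omega)).1
    · simp only [upar]
      split_ifs with h
      · exact (y.val.f0 (by omega)).symm
      · exact (hC (by omega)).2
  obtain ⟨w, hw⟩ : ∃ w, T.Ch w y.x := T.ext y.x
  have hwl := hw.1
  rcases lt_trichotomy (T.lev y.x) (K + 1) with hl | hl | hl
  · -- low levels
    refine mk w Set.univ Set.univ false hw ?_ (by omega) (by omega)
    constructor
    · intro _; rfl
    · intro _
      refine ⟨trivial, fun z _ _ => ⟨fun _ => ?_, fun _ _ _ => trivial⟩⟩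
      obtain ⟨c, hc⟩ := T.ext z
      exact ⟨c, hc, trivial⟩
    · intro _; rfl
    · intro _; rfl
    · omega
    · omega
    · omega
  · -- level K + 1
    have hQ := y.val.s1 (by omega)
    have hxS : y.x ∈ y.S := by
      have := hQ.1
      rwa [anc_of_le (by omega)] at this
    have hwS : w ∈ y.S := (hQ.2 _ hxS (by omega)).2 (by omega) w hw
    have haw : T.anc (K + 1) w = T.anc (K + 1) y.x := anc_ch hw (by omega)
    by_cases hu : ∃ u ∈ y.S, K + 2 ≤ T.lev u ∧ T.anc (K + 2) u = w ∧ Out A u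
    · obtain ⟨u, huS, hul, hua, huo⟩ := hu
      refine mk w y.S (Cone u) false hw ?_ (fun _ => rfl) (by omega)
      constructor
      · omega
      · intro _; rw [haw]; exact hQ
      · omega
      · intro _; rfl
      · intro _ _
        exact ⟨u, huS, hul, by rw [hua, anc_of_le (by omega)], huo, rfl⟩
      · intro _ h; cases h
      · intro m h1 h2
        obtain rfl : m = K + 2 := by omega
        rw [anc_of_le (by omega), ← hua]
        exact anc_mem_cone u _
    · push Not at hu
      let C : Set T.V := {z | z ∈ y.S ∧ K + 2 ≤ T.lev z ∧ T.anc (K + 2) z = w}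
      have hwC : w ∈ C := ⟨hwS, by omega, anc_of_le (by omega)⟩
      refine mk w y.S C true hw ?_ (fun _ => rfl) (by omega)
      constructor
      · omega
      · intro _; rw [haw]; exact hQ
      · omega
      · omega
      · intro _ h; cases h
      · intro _ _
        refine ⟨by rw [anc_of_le (by omega)]; exact hwC, fun z hz => hz.1,
          fun z hz => hu z hz.1 hz.2.1 hz.2.2, fun z hz hzl => ⟨fun ho => ?_, fun _ c hc hcS => ?_⟩⟩
        · obtain ⟨c, hc⟩ : ∃ c, T.Ch c z := T.ext z
          refine ⟨c, hc, (hQ.2 _ hz.1 (by omega)).2 ho c hc, by rw [hc.1]; omega, ?_⟩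
          rw [anc_ch hc (by omega)]
          exact hz.2.2
        · refine ⟨hcS, by rw [hc.1]; omega, ?_⟩
          rw [anc_ch hc (by omega)]
          exact hz.2.2
      · intro m h1 h2
        obtain rfl : m = K + 2 := by omega
        rw [anc_of_le (by omega)]
        exact hwC
  · -- high levels
    have hQ := y.val.s1 (by omega)
    have key : ∃ c, T.Ch c y.x ∧ c ∈ y.C := by
      have hxC : y.x ∈ y.C := by
        have := y.val.c3 (T.lev y.x) (by omega) le_rfl
        rwa [anc_self] at this
      rcases hfl : y.fl with _ | _
      · obtain ⟨u, huS, hul, hua, huo, hC⟩ := y.val.c1 (by omega) hfl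
        rw [hC] at hxC ⊢
        rcases Nat.lt_or_ge (T.lev y.x) (T.lev u) with h | h
        · have h1 := cone_low hxC h.le
          refine ⟨T.anc (T.lev y.x + 1) u, ?_, anc_mem_cone u _⟩
          have := ch_anc (T := T) (m := T.lev y.x) (x := u) h
          rwa [h1] at this
        · refine ⟨w, hw, cone_of_anc ?_⟩
          rw [anc_ch hw h]
          exact cone_high hxC h
      · obtain ⟨hb, hCS, hno, hq⟩ := y.val.c2 (by omega) hfl
        rcases Nat.mod_two_eq_zero_or_one (T.lev y.x) with h | h
        · obtain ⟨c, hc, hcS⟩ := (hQ.2 _ (hCS hxC) (by omega)).1 h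
          exact ⟨c, hc, (hq _ hxC (by omega)).2 h c hc hcS⟩
        · exact (hq _ hxC (by omega)).1 h
    obtain ⟨c, hc, hcC⟩ := key
    have hcl := hc.1
    refine mk c y.S y.C y.fl hc ?_ (fun _ => rfl) (fun _ => ⟨rfl, rfl⟩)
    constructor
    · omega
    · intro _; rw [anc_ch hc (by omega)]; exact hQ
    · omega
    · omega
    · intro _ h; rw [anc_ch hc (by omega)]; exact y.val.c1 (by omega) h
    · intro _ h; rw [anc_ch hc (by omega)]; exact y.val.c2 (by omega) h
    · intro m h1 h2
      rcases Nat.lt_or_ge (T.lev y.x) m with h | h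
      · rw [anc_of_le (by omega)]; exact hcC
      · rw [anc_ch hc h]; exact y.val.c3 m h1 h

variable (K A) in
/-- The unraveled tree. -/
def utree (hK : K % 2 = 0) : BTree.{v} :=
  { V := UNode K A
    lev := fun y => T.lev y.x
    par := upar
    lev_par := fun y => T.lev_par y.x
    par_root := fun y h => by
      apply UNode.ext'
      · exact T.par_root y.x h
      · simp only [upar]; rw [if_pos (by omega), y.val.s0 (by omega)]
      · simp only [upar]; rw [if_pos (by omega), y.val.c0 (by omega)]
      · simp only [upar]; rw [if_pos (by omega), y.val.f0 (by omega)]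
    ext := upar_ext hK }

/-- Children of unraveled nodes. -/
structure UCh (y z : UNode K A) : Prop where
  ch : T.Ch y.x z.x
  S : K + 1 ≤ T.lev z.x → y.S = z.S
  C : K + 2 ≤ T.lev z.x → y.C = z.C
  fl : K + 2 ≤ T.lev z.x → y.fl = z.fl

theorem uch {hK : K % 2 = 0} {y z : UNode K A} (h : (utree K A hK).Ch y z) : UCh y z := by
  obtain ⟨h1, h2⟩ := h
  change T.lev y.x = T.lev z.x + 1 at h1
  change upar y = z at h2
  subst h2
  change T.lev y.x = T.lev (T.par y.x) + 1 at h1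
  refine ⟨⟨h1, rfl⟩, fun h => ?_, fun h => ?_, fun h => ?_⟩ <;>
  · simp only [upar] at h ⊢
    rw [if_neg (by omega)]

theorem UCh.eq {y y' z : UNode K A} (h : UCh y z) (h' : UCh y' z) (hx : y.x = y'.x)
    (hS : T.lev z.x = K → y.S = y'.S) (hC : T.lev z.x = K + 1 → y.C = y'.C)
    (hfl : T.lev z.x = K + 1 → y.fl = y'.fl) : y = y' := by
  have l1 := h.ch.1
  have l2 := h'.ch.1
  apply UNode.ext' hx
  · rcases lt_trichotomy (T.lev z.x) K with hl | hl | hl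
    · rw [y.val.s0 (by omega), y'.val.s0 (by omega)]
    · exact hS hl
    · rw [h.S hl, h'.S hl]
  · rcases lt_trichotomy (T.lev z.x) (K + 1) with hl | hl | hl
    · rw [y.val.c0 (by omega), y'.val.c0 (by omega)]
    · exact hC hl
    · rw [h.C hl, h'.C hl]
  · rcases lt_trichotomy (T.lev z.x) (K + 1) with hl | hl | hl
    · rw [y.val.f0 (by omega), y'.val.f0 (by omega)]
    · exact hfl hl
    · rw [h.fl hl, h'.fl hl]

/-- Node on a play. -/
def mkNode (x : T.Play) (S C : Set T.V) (fl : Bool) (hS : QI K (x.1 (K + 1)) S)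
    (h1 : fl = false → QC1 K A (x.1 (K + 2)) S C) (h2 : fl = true → QC2 K A (x.1 (K + 2)) S C)
    (n : ℕ) (hC : ∀ m, K + 2 ≤ m → m ≤ n → x.1 m ∈ C) : UNode K A :=
  { x := x.1 n
    S := if n ≤ K then Set.univ else S
    C := if n ≤ K + 1 then Set.univ else C
    fl := if n ≤ K + 1 then false else fl
    val := by
      have hl := x.lev n
      constructor
      · intro h; rw [if_pos (by omega)]
      · intro h; rw [if_neg (by omega), x.anc (by omega)]; exact hS
      · intro h; rw [if_pos (by omega)]
      · intro h; rw [if_pos (by omega)]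
      · intro h
        rw [if_neg (by omega), if_neg (by omega), if_neg (by omega), x.anc (by omega)]
        exact h1
      · intro h
        rw [if_neg (by omega), if_neg (by omega), if_neg (by omega), x.anc (by omega)]
        exact h2
      · intro m h3 h4
        rw [if_neg (by omega), x.anc (by omega)]
        exact hC m h3 (by omega) }

/-- Lifted plays. -/
def mkPlay (hK : K % 2 = 0) (x : T.Play) (S C : Set T.V) (fl : Bool) (hS : QI K (x.1 (K + 1)) S)
    (h1 : fl = false → QC1 K A (x.1 (K + 2)) S C) (h2 : fl = true → QC2 K A (x.1 (K + 2)) S C)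
    (hC : ∀ m, K + 2 ≤ m → x.1 m ∈ C) : (utree K A hK).Play :=
  ⟨fun n => mkNode x S C fl hS h1 h2 n (fun m h _ => hC m h), x.2.1, fun n => by
    refine ⟨(x.ch n).1, ?_⟩
    have hl := x.lev (n + 1)
    apply UNode.ext'
    · exact (x.ch n).2
    · change (if T.lev (x.1 (n + 1)) ≤ K + 1 then Set.univ
        else if n + 1 ≤ K then Set.univ else S) = if n ≤ K then Set.univ else S
      rw [hl]
      split_ifs <;> first | rfl | omega
    · change (if T.lev (x.1 (n + 1)) ≤ K + 2 then Set.univ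
        else if n + 1 ≤ K + 1 then Set.univ else C) = if n ≤ K + 1 then Set.univ else C
      rw [hl]
      split_ifs <;> first | rfl | omega
    · change (if T.lev (x.1 (n + 1)) ≤ K + 2 then false
        else if n + 1 ≤ K + 1 then false else fl) = if n ≤ K + 1 then false else fl
      rw [hl]
      split_ifs <;> first | rfl | omega⟩

open Classical in
/-- Response of a strategy. -/
noncomputable def resp {hK : K % 2 = 0} (s : (utree K A hK).Str) (x : T.V) (S C : Set T.V)
    (fl : Bool) : T.V × Set T.V × Set T.V × Bool :=
  if h : Val K A x S C fl then
    let r : UNode K A := s.1 (⟨x, S, C, fl, h⟩ : UNode K A)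
    (r.x, r.S, r.C, r.fl)
  else (T.dft x, Set.univ, Set.univ, false)

variable {hK : K % 2 = 0}

/-- apply strategy -/
def app (s : (utree K A hK).Str) (y : UNode K A) : UNode K A := s.1 y

theorem app_ch (s : (utree K A hK).Str) (y : UNode K A) : UCh (app s y) y := uch (s.2 y)

theorem resp_eq (s : (utree K A hK).Str) (y : UNode K A) :
    resp s y.x y.S y.C y.fl = ((app s y).x, (app s y).S, (app s y).C, (app s y).fl) := by
  rw [resp, dif_pos y.val]
  rfl

theorem resp_ch (s : (utree K A hK).Str) (x : T.V) (S C : Set T.V) (fl : Bool) :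
    T.Ch (resp s x S C fl).1 x := by
  by_cases h : Val K A x S C fl
  · have := resp_eq s ⟨x, S, C, fl, h⟩
    dsimp only at this
    rw [this]
    exact (app_ch s ⟨x, S, C, fl, h⟩).ch
  · rw [resp, dif_neg h]
    exact dft_ch x

theorem resp_loc (s t : (utree K A hK).Str) (n : ℕ)
    (h : ∀ y, (utree K A hK).lev y < n → s.1 y = t.1 y) (x : T.V) (hx : T.lev x < n) :
    resp s x = resp t x := by
  funext S C fl
  by_cases hv : Val K A x S C fl
  · have e : app s ⟨x, S, C, fl, hv⟩ = app t ⟨x, S, C, fl, hv⟩ := h _ hx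
    have h1 := resp_eq s ⟨x, S, C, fl, hv⟩
    have h2 := resp_eq t ⟨x, S, C, fl, hv⟩
    dsimp only at h1 h2
    rw [h1, h2, e]
  · rw [resp, dif_neg hv, resp, dif_neg hv]

theorem val_low {x : T.V} (hx : T.lev x ≤ K) : Val K A x Set.univ Set.univ false := by
  constructor
  · intro _; rfl
  · omega
  · intro _; rfl
  · intro _; rfl
  · omega
  · omega
  · omega

theorem node_low (y : UNode K A) (hx : T.lev y.x ≤ K) :
    y = ⟨y.x, Set.univ, Set.univ, false, val_low hx⟩ :=
  UNode.ext' rfl (y.val.s0 hx) (y.val.c0 (by omega)) (y.val.f0 (by omega))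

theorem resp_low (s : (utree K A hK).Str) (y : UNode K A) (hx : T.lev y.x ≤ K) :
    resp s y.x Set.univ Set.univ false =
      ((app s y).x, (app s y).S, (app s y).C, (app s y).fl) := by
  rw [← resp_eq s y, y.val.s0 hx, y.val.c0 (by omega), y.val.f0 (by omega)]

/-- Criterion for consistency of a lifted play. -/
theorem mkPlay_cons (s : (utree K A hK).Str) (x : T.Play) (S C : Set T.V) (fl : Bool)
    (hS : QI K (x.1 (K + 1)) S)
    (h1 : fl = false → QC1 K A (x.1 (K + 2)) S C) (h2 : fl = true → QC2 K A (x.1 (K + 2)) S C)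
    (hC : ∀ m, K + 2 ≤ m → x.1 m ∈ C) (n : ℕ)
    (e0 : n ≤ K → x.1 (n + 1) = (resp s (x.1 n) Set.univ Set.univ false).1)
    (e1 : n = K → S = (resp s (x.1 n) Set.univ Set.univ false).2.1)
    (e2 : n = K + 1 → resp s (x.1 n) S Set.univ false = (x.1 (n + 1), S, C, fl))
    (e3 : K + 2 ≤ n → x.1 (n + 1) = (resp s (x.1 n) S C fl).1) :
    (mkPlay hK x S C fl hS h1 h2 hC).1 (n + 1) = s.1 ((mkPlay hK x S C fl hS h1 h2 hC).1 n) := by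
  set Y := mkPlay hK x S C fl hS h1 h2 hC with hY
  let y : UNode K A := Y.1 n
  let y' : UNode K A := Y.1 (n + 1)
  have hc1 : UCh y' y := uch (Y.ch n)
  have hc2 : UCh (app s y) y := app_ch s y
  have hl : T.lev y.x = n := x.lev n
  have r := resp_eq s y
  have yx : y.x = x.1 n := rfl
  have yS : y.S = if n ≤ K then Set.univ else S := rfl
  have yC : y.C = if n ≤ K + 1 then Set.univ else C := rfl
  have yf : y.fl = if n ≤ K + 1 then false else fl := rfl
  have yx' : y'.x = x.1 (n + 1) := rfl
  have yS' : y'.S = if n + 1 ≤ K then Set.univ else S := rfl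
  have yC' : y'.C = if n + 1 ≤ K + 1 then Set.univ else C := rfl
  have yf' : y'.fl = if n + 1 ≤ K + 1 then false else fl := rfl
  rw [yx, yS, yC, yf] at r
  change y' = app s y
  apply UCh.eq hc1 hc2
  · rw [yx']
    rcases lt_trichotomy n (K + 1) with h | h | h
    · rw [if_pos (by omega), if_pos (by omega), if_pos (by omega)] at r
      rw [e0 (by omega), r]
    · rw [if_neg (by omega), if_pos (by omega), if_pos (by omega), e2 h] at r
      exact congrArg Prod.fst r
    · rw [if_neg (by omega), if_neg (by omega), if_neg (by omega)] at r
      rw [e3 h, r]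
  · intro h
    rw [hl] at h
    rw [if_pos (by omega), if_pos (by omega), if_pos (by omega)] at r
    rw [yS', if_neg (by omega), e1 h, r]
  · intro h
    rw [hl] at h
    rw [if_neg (by omega), if_pos (by omega), if_pos (by omega), e2 h] at r
    rw [yC', if_neg (by omega)]
    exact congrArg (fun p => p.2.2.1) r
  · intro h
    rw [hl] at h
    rw [if_neg (by omega), if_pos (by omega), if_pos (by omega), e2 h] at r
    rw [yf', if_neg (by omega)]
    exact congrArg (fun p => p.2.2.2) r

/-- Before reaching `u` the cone forces the moves. -/
theorem resp_cone (s : (utree K A hK).Str) (x : T.Play) (S : Set T.V) (m n : ℕ)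
    (hn : K + 2 ≤ n) (hnm : n < m) (hv : Val K A (x.1 n) S (Cone (x.1 m)) false) :
    x.1 (n + 1) = (resp s (x.1 n) S (Cone (x.1 m)) false).1 := by
  have r := resp_eq s ⟨_, _, _, _, hv⟩
  have c := app_ch s ⟨_, _, _, _, hv⟩
  have hl := x.lev n
  have c1 := c.ch.1
  have c2 := c.C (by dsimp only; omega)
  generalize app s ⟨_, _, _, _, hv⟩ = z at r c1 c2
  dsimp only at r c1 c2
  rw [r]
  have hz := z.val.c3 (n + 1) (by omega) (by omega)
  rw [anc_of_le (by omega), c2] at hz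
  have := cone_low hz (by rw [x.lev]; omega)
  rw [c1, hl, x.anc (by omega)] at this
  exact this

end BUnr


namespace BUnr

variable {T : BTree.{v}} {K : ℕ} {A : Set T.Play} {hK : K % 2 = 0}

theorem val_play (x : T.Play) (S C : Set T.V) (fl : Bool) (hS : QI K (x.1 (K + 1)) S)
    (h1 : fl = false → QC1 K A (x.1 (K + 2)) S C) (h2 : fl = true → QC2 K A (x.1 (K + 2)) S C)
    (n : ℕ) (hn : K + 2 ≤ n) (hC : ∀ m, K + 2 ≤ m → m ≤ n → x.1 m ∈ C) :
    Val K A (x.1 n) S C fl := by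
  have h := (mkNode x S C fl hS h1 h2 n hC).val
  simp only [mkNode] at h
  rwa [if_neg (by omega), if_neg (by omega), if_neg (by omega)] at h

theorem val_mid {a : T.V} {S : Set T.V} (hl : T.lev a = K + 1) (hS : QI K a S) :
    Val K A a S Set.univ false := by
  constructor
  · omega
  · intro _; rw [anc_of_le hl.le]; exact hS
  · intro _; rfl
  · intro _; rfl
  · omega
  · omega
  · omega

/-- The response stays in `C`. -/
theorem resp_mem (s : (utree K A hK).Str) {x : T.V} {S C : Set T.V} {fl : Bool}
    (hv : Val K A x S C fl) (hl : K + 2 ≤ T.lev x) : (resp s x S C fl).1 ∈ C := by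
  have r := resp_eq s ⟨_, _, _, _, hv⟩
  have c := app_ch s ⟨_, _, _, _, hv⟩
  have c1 := c.ch.1
  have c2 := c.C hl
  generalize app s ⟨_, _, _, _, hv⟩ = z at r c1 c2
  dsimp only at r c1 c2
  rw [r]
  have hz := z.val.c3 (T.lev z.x) (by omega) le_rfl
  rwa [anc_self, c2] at hz

theorem resp_K (s : (utree K A hK).Str) {x : T.V} (hl : T.lev x = K) :
    QI K (resp s x Set.univ Set.univ false).1 (resp s x Set.univ Set.univ false).2.1 := by
  have hv : Val K A x Set.univ Set.univ false := val_low hl.le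
  have r := resp_eq s ⟨_, _, _, _, hv⟩
  have c := app_ch s ⟨_, _, _, _, hv⟩
  have c1 := c.ch.1
  generalize app s ⟨_, _, _, _, hv⟩ = z at r c1
  dsimp only at r c1
  rw [r]
  have hz := z.val.s1 (by omega)
  rwa [anc_of_le (by omega)] at hz

/-! ### First player -/

variable (K A) in
/-- Target. -/
def UI (S : Set T.V) : Set T.V := {w | w ∈ S ∧ K + 2 ≤ T.lev w ∧ Out A w}

/-- even level -/
def ev (w : T.V) : Prop := T.lev w % 2 = 0

/-- odd level -/
def od (w : T.V) : Prop := T.lev w % 2 = 1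

variable (K A) in
/-- Safe set. -/
def CI (S : Set T.V) : Set T.V := {w | w ∈ S ∧ K + 2 ≤ T.lev w ∧ w ∉ T.Attr ev S (UI K A S)}

variable (K A) in
/-- Safe. -/
def SafeI (S : Set T.V) (v : T.V) : Prop := ∀ m, K + 2 ≤ m → m ≤ T.lev v → T.anc m v ∈ CI K A S

open Classical in
/-- The strategy of the first player. -/
noncomputable def phiI (s : (utree K A hK).Str) (v : T.V) : T.V :=
  if T.lev v ≤ K then (resp s v Set.univ Set.univ false).1 else
    let S := (resp s (T.anc K v) Set.univ Set.univ false).2.1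
    T.steer ev S (UI K A S) (K + 2) (SafeI K A S) (fun y => (resp s y S (CI K A S) true).1)
      (fun y => (resp s y S (Cone (T.firstU (K + 2) (UI K A S) y)) false).1) v

theorem phiI_ch (s : (utree K A hK).Str) (v : T.V) : T.Ch (phiI s v) v := by
  unfold phiI
  split_ifs
  · exact resp_ch _ _ _ _ _
  · exact steer_ch (fun x => resp_ch _ _ _ _ _) (fun x => resp_ch _ _ _ _ _) v

theorem phiI_loc (s t : (utree K A hK).Str) (n : ℕ)
    (h : ∀ y, (utree K A hK).lev y < n → s.1 y = t.1 y) (x : T.V) (hx : T.lev x < n) :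
    phiI s x = phiI t x := by
  unfold phiI
  have h1 : resp s (T.anc K x) = resp t (T.anc K x) :=
    resp_loc s t n h _ (by rw [lev_anc]; omega)
  have h2 : resp s x = resp t x := resp_loc s t n h _ hx
  rw [h1, h2]
  split_ifs
  · rfl
  · apply steer_congr
    · rw [h2]
    · rw [h2]

theorem ci_qc2 {a b : T.V} {S : Set T.V} (hS : QI K a S) (hb : b ∈ CI K A S) :
    QC2 K A b S (CI K A S) := by
  refine ⟨hb, fun w hw => hw.1, fun w hw ho => hw.2.2 (attr_hit ⟨hw.1, hw.2.1, ho⟩),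
    fun w hw hl => ⟨fun ho => ?_, fun he c hc hcS => ?_⟩⟩
  · by_contra! hno
    apply hw.2.2
    apply attr_theirs
    · unfold ev; omega
    · intro y hy hyS
      by_contra hyA
      exact hno y hy ⟨hyS, by rw [hy.1]; omega, hyA⟩
  · refine ⟨hcS, by rw [hc.1]; omega, fun hcA => hw.2.2 (attr_mine he hc hcS hcA)⟩

theorem phiI_lift (s : (utree K A hK).Str) (x : T.Play)
    (hx : ∀ n, n % 2 = 0 → x.1 (n + 1) = phiI s (x.1 n)) :
    ∃ y : (utree K A hK).Play, Cons true s y ∧ ∀ n, UNode.x (y.1 n) = x.1 n := by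
  obtain ⟨S, hSdef⟩ : ∃ S, S = (resp s (x.1 K) Set.univ Set.univ false).2.1 := ⟨_, rfl⟩
  have hlow : ∀ n, n % 2 = 0 → n ≤ K → x.1 (n + 1) = (resp s (x.1 n) Set.univ Set.univ false).1 := by
    intro n hn hl
    rw [hx n hn, phiI, if_pos (by rwa [x.lev])]
  have hQ : QI K (x.1 (K + 1)) S := by
    rw [hSdef, hlow K hK le_rfl]
    exact resp_K s (x.lev K)
  have hoddS : ∀ n, K + 1 ≤ n → n % 2 = 1 → x.1 n ∈ S → x.1 (n + 1) ∈ S := by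
    intro n h1 h2 h3
    exact (hQ.2 _ h3 (by rwa [x.lev])).2 (by rwa [x.lev]) _ (x.ch n)
  have h2S : x.1 (K + 2) ∈ S := hoddS (K + 1) le_rfl (by omega) hQ.1
  have hsafe : ∀ n, SafeI K A S (x.1 n) ↔ ∀ m, K + 2 ≤ m → m ≤ n → x.1 m ∈ CI K A S := by
    intro n
    unfold SafeI
    rw [x.lev]
    refine forall_congr' fun m => forall_congr' fun h1 => forall_congr' fun h2 => ?_
    rw [x.anc h2]
  have hvalS : ∀ n, K + 2 ≤ n → SafeI K A S (x.1 n) → Val K A (x.1 n) S (CI K A S) true := by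
    intro n hn hs
    rw [hsafe] at hs
    exact val_play x S _ true hQ (by simp) (fun _ => ci_qc2 hQ (hs _ le_rfl hn)) n hn hs
  have hsucc : ∀ n, K + 2 ≤ n → SafeI K A S (x.1 n) → ∀ y, T.Ch y (x.1 n) → y ∈ CI K A S →
      SafeI K A S y := by
    intro n hn hs y hy hyC m h1 h2
    have := hy.1
    rcases Nat.lt_or_ge m (T.lev y) with h | h
    · rw [anc_ch hy (by omega)]
      exact hs m h1 (by omega)
    · rwa [anc_of_le h]
  have spec := steer_spec (P := ev) (M := S) (U := UI K A S) (L := K + 2) (Safe := SafeI K A S)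
    (g0 := fun y => (resp s y S (CI K A S) true).1)
    (g1 := fun y => (resp s y S (Cone (T.firstU (K + 2) (UI K A S) y)) false).1) x
    (by
      intro n hn hp
      have hp' : n % 2 = 0 := by
        unfold ev at hp
        rwa [x.lev] at hp
      rw [hx n hp', phiI, if_neg (by rw [x.lev]; omega), x.anc (by omega), ← hSdef])
    (by
      by_cases h : x.1 (K + 2) ∈ T.Attr ev S (UI K A S)
      · exact Or.inr ⟨h2S, h⟩
      · left
        rw [hsafe]
        intro m h1 h2
        obtain rfl : m = K + 2 := by omega
        exact ⟨h2S, by rw [x.lev], h⟩)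
    (by
      intro n hn h1 h2
      unfold ev at h2
      rw [x.lev] at h2
      exact hoddS n (by omega) (by omega) h1)
    (by
      intro n hn hs hp
      apply hsucc n hn hs _ (resp_ch _ _ _ _ _)
      exact resp_mem s (hvalS n hn hs) (by rw [x.lev]; omega))
    (by
      intro n hn hs hp
      unfold ev at hp
      rw [x.lev] at hp
      have h1 : x.1 (n + 1) ∈ S := hoddS n (by omega) (by omega) (((hsafe n).1 hs) n hn le_rfl).1
      by_cases h : x.1 (n + 1) ∈ T.Attr ev S (UI K A S)
      · exact Or.inr ⟨h1, h⟩
      · left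
        exact hsucc n hn hs _ (x.ch n) ⟨h1, by rw [x.lev]; omega, h⟩)
    (by
      intro n hn hs hU
      exact (((hsafe n).1 hs) n hn le_rfl).2.2 (attr_hit hU))
    (by
      intro n hn hs
      rw [hsafe] at hs ⊢
      exact fun m h1 h2 => hs m h1 (by omega))
  rcases spec with h | ⟨m, hm, hU, h⟩
  · have hC : ∀ m, K + 2 ≤ m → x.1 m ∈ CI K A S := fun m hm =>
      ((hsafe m).1 (h m hm).1) m hm le_rfl
    refine ⟨mkPlay hK x S (CI K A S) true hQ (by simp) (fun _ => ci_qc2 hQ (hC _ le_rfl)) hC,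
      fun n hn => ?_, fun n => rfl⟩
    change n % 2 = 0 at hn
    apply mkPlay_cons
    · exact hlow n hn
    · rintro rfl; exact hSdef
    · omega
    · intro hn2
      exact (h n hn2).2 (by unfold ev; rwa [x.lev])
  · have hq1 : QC1 K A (x.1 (K + 2)) S (Cone (x.1 m)) :=
      ⟨x.1 m, hU.1, hU.2.1, x.anc hm, hU.2.2, rfl⟩
    have hC : ∀ j, K + 2 ≤ j → x.1 j ∈ Cone (x.1 m) := by
      intro j hj
      rcases Nat.le_total j m with h1 | h1
      · rw [← x.anc h1]; exact anc_mem_cone _ _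
      · apply cone_of_anc
        rw [x.lev, x.anc h1]
    refine ⟨mkPlay hK x S (Cone (x.1 m)) false hQ (fun _ => hq1) (by simp) hC,
      fun n hn => ?_, fun n => rfl⟩
    change n % 2 = 0 at hn
    apply mkPlay_cons
    · exact hlow n hn
    · rintro rfl; exact hSdef
    · omega
    · intro hn2
      rcases Nat.lt_or_ge n m with h1 | h1
      · exact resp_cone s x S m n hn2 h1
          (val_play x S _ false hQ (fun _ => hq1) (by simp) n hn2 (fun j hj _ => hC j hj))
      · obtain ⟨h2, h3⟩ := h n h1
        have := h3 (by unfold ev; rwa [x.lev])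
        rw [h2] at this
        exact this

/-! ### Second player -/

/-- The challenge conditions. -/
def Chal (K : ℕ) (a : T.V) (R : Set T.V → Set T.V → Bool → T.V × Set T.V × Set T.V × Bool)
    (w : T.V) (S : Set T.V) : Prop :=
  QI K a S ∧ w ∈ S ∧ (R S Set.univ false).1 = T.anc (K + 2) w ∧
    (R S Set.univ false).2.2.1 = Cone w ∧ (R S Set.univ false).2.2.2 = false

/-- Target. -/
def UII (K : ℕ) (a : T.V) (R : Set T.V → Set T.V → Bool → T.V × Set T.V × Set T.V × Bool) :
    Set T.V := {w | K + 2 ≤ T.lev w ∧ ∃ S, Chal K a R w S}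

/-- Complement of the attractor. -/
def SII (K : ℕ) (a : T.V) (R : Set T.V → Set T.V → Bool → T.V × Set T.V × Set T.V × Bool) :
    Set T.V := (T.Attr od Set.univ (UII K a R))ᶜ

/-- Safe set. -/
def CII (K : ℕ) (a : T.V) (R : Set T.V → Set T.V → Bool → T.V × Set T.V × Set T.V × Bool) :
    Set T.V := (R (SII K a R) Set.univ false).2.2.1

/-- Safe. -/
def SafeII (K : ℕ) (a : T.V) (R : Set T.V → Set T.V → Bool → T.V × Set T.V × Set T.V × Bool)
    (w : T.V) : Prop :=
  T.anc (K + 1) w ∈ SII K a R ∧ ∀ m, K + 2 ≤ m → m ≤ T.lev w → T.anc m w ∈ CII K a R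

open Classical in
/-- Chosen quasistrategy. -/
noncomputable def chS (K : ℕ) (a : T.V)
    (R : Set T.V → Set T.V → Bool → T.V × Set T.V × Set T.V × Bool) (w : T.V) : Set T.V :=
  if h : ∃ S, Chal K a R w S then h.choose else Set.univ

open Classical in
/-- The strategy of the second player. -/
noncomputable def phiII (s : (utree K A hK).Str) (v : T.V) : T.V :=
  if T.lev v ≤ K then (resp s v Set.univ Set.univ false).1 else
    let a := T.anc (K + 1) v
    let R := resp s a
    T.steer od Set.univ (UII K a R) (K + 1) (SafeII K a R)
      (fun y => if T.lev y = K + 1 then (resp s y (SII K a R) Set.univ false).1 else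
        (resp s y (SII K a R) (CII K a R) true).1)
      (fun y => (resp s y (chS K a R (T.firstU (K + 1) (UII K a R) y))
        (Cone (T.firstU (K + 1) (UII K a R) y)) false).1) v

theorem phiII_ch (s : (utree K A hK).Str) (v : T.V) : T.Ch (phiII s v) v := by
  unfold phiII
  split_ifs
  · exact resp_ch _ _ _ _ _
  · refine steer_ch (fun x => ?_) (fun x => resp_ch _ _ _ _ _) v
    split_ifs
    · exact resp_ch _ _ _ _ _
    · exact resp_ch _ _ _ _ _

theorem phiII_loc (s t : (utree K A hK).Str) (n : ℕ)
    (h : ∀ y, (utree K A hK).lev y < n → s.1 y = t.1 y) (x : T.V) (hx : T.lev x < n) :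
    phiII s x = phiII t x := by
  unfold phiII
  dsimp only
  have h1 : resp s (T.anc (K + 1) x) = resp t (T.anc (K + 1) x) :=
    resp_loc s t n h _ (by rw [lev_anc]; omega)
  have h2 : resp s x = resp t x := resp_loc s t n h _ hx
  rw [h1, h2]
  split_ifs
  · rfl
  · apply steer_congr
    · rw [h2]
    · rw [h2]

/-- data about the response at level `K+1` -/
theorem resp_mid (s : (utree K A hK).Str) {a : T.V} {S : Set T.V} (hl : T.lev a = K + 1)
    (hS : QI K a S) :
    (resp s a S Set.univ false).2.1 = S ∧
    ((resp s a S Set.univ false).2.2.2 = false →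
      QC1 K A (resp s a S Set.univ false).1 S (resp s a S Set.univ false).2.2.1) ∧
    ((resp s a S Set.univ false).2.2.2 = true →
      QC2 K A (resp s a S Set.univ false).1 S (resp s a S Set.univ false).2.2.1) := by
  have hv : Val K A a S Set.univ false := val_mid hl hS
  have r := resp_eq s ⟨_, _, _, _, hv⟩
  have c := app_ch s ⟨_, _, _, _, hv⟩
  have c1 := c.ch.1
  have c2 := c.S hl.ge
  generalize app s ⟨_, _, _, _, hv⟩ = z at r c1 c2
  dsimp only at r c1 c2
  rw [r]
  have e : T.anc (K + 2) z.x = z.x := anc_of_le (by omega)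
  have h1 := z.val.c1 (by omega)
  have h2 := z.val.c2 (by omega)
  rw [e, c2] at h1 h2
  exact ⟨c2, h1, h2⟩

theorem sii_qi {a : T.V} {R : Set T.V → Set T.V → Bool → T.V × Set T.V × Set T.V × Bool}
    (ha : a ∈ SII K a R) : QI K a (SII K a R) := by
  refine ⟨ha, fun w hw hl => ⟨fun he => ?_, fun ho c hc hcA => hw (attr_mine ho hc trivial hcA)⟩⟩
  by_contra! hno
  apply hw
  apply attr_theirs
  · unfold od; omega
  · intro y hy _
    by_contra hyA
    exact hno y hy hyA

theorem cii_qc2 (s : (utree K A hK).Str) {a : T.V} (hl : T.lev a = K + 1)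
    (ha : a ∈ SII K a (resp s a)) :
    (resp s a (SII K a (resp s a)) Set.univ false).2.2.2 = true ∧
    QC2 K A (resp s a (SII K a (resp s a)) Set.univ false).1 (SII K a (resp s a))
      (CII K a (resp s a)) := by
  have hQ := sii_qi ha
  obtain ⟨h1, h2, h3⟩ := resp_mid s hl hQ
  have hfl : (resp s a (SII K a (resp s a)) Set.univ false).2.2.2 = true := by
    by_contra hc
    rw [Bool.not_eq_true] at hc
    obtain ⟨u, hu, hul, hua, huo, huC⟩ := h2 hc
    exact hu (attr_hit ⟨hul, _, hQ, hu, hua.symm, huC, hc⟩)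
  exact ⟨hfl, h3 hfl⟩

theorem phiII_lift (s : (utree K A hK).Str) (x : T.Play)
    (hx : ∀ n, n % 2 = 1 → x.1 (n + 1) = phiII s (x.1 n)) :
    ∃ y : (utree K A hK).Play, Cons false s y ∧ ∀ n, UNode.x (y.1 n) = x.1 n := by
  classical
  obtain ⟨a, ha⟩ : ∃ a, a = x.1 (K + 1) := ⟨_, rfl⟩
  have hal : T.lev a = K + 1 := by rw [ha, x.lev]
  obtain ⟨R, hR⟩ : ∃ R, R = resp s a := ⟨_, rfl⟩
  have hlow : ∀ n, n % 2 = 1 → n ≤ K → x.1 (n + 1) = (resp s (x.1 n) Set.univ Set.univ false).1 := by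
    intro n hn hl
    rw [hx n hn, phiII, if_pos (by rwa [x.lev])]
  have hsafe : ∀ n, K + 1 ≤ n → (SafeII K a R (x.1 n) ↔
      a ∈ SII K a R ∧ ∀ m, K + 2 ≤ m → m ≤ n → x.1 m ∈ CII K a R) := by
    intro n hn
    unfold SafeII
    rw [x.lev, x.anc hn, ← ha]
    refine and_congr_right fun _ => forall_congr' fun m => forall_congr' fun h1 =>
      forall_congr' fun h2 => ?_
    rw [x.anc h2]
  have hq2 : ∀ b, a ∈ SII K a R → b ∈ CII K a R → QC2 K A b (SII K a R) (CII K a R) := by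
    intro b h1 h2
    rw [hR] at h1 h2 ⊢
    exact ⟨h2, (cii_qc2 s hal h1).2.2⟩
  have hvalS : ∀ n, K + 2 ≤ n → SafeII K a R (x.1 n) →
      Val K A (x.1 n) (SII K a R) (CII K a R) true := by
    intro n hn hs
    rw [hsafe n (by omega)] at hs
    exact val_play x _ _ true (by rw [← ha]; exact sii_qi hs.1) (by simp)
      (fun _ => hq2 _ hs.1 (hs.2 _ le_rfl hn)) n hn hs.2
  have hsucc : ∀ n, K + 1 ≤ n → SafeII K a R (x.1 n) → ∀ y, T.Ch y (x.1 n) → y ∈ CII K a R →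
      SafeII K a R y := by
    intro n hn hs y hy hyC
    have := hy.1
    have hxl := x.lev n
    refine ⟨by rw [anc_ch hy (by omega)]; exact hs.1, fun m h1 h2 => ?_⟩
    rcases Nat.lt_or_ge m (T.lev y) with h | h
    · rw [anc_ch hy (by omega)]
      exact hs.2 m h1 (by omega)
    · rwa [anc_of_le h]
  have spec := steer_spec (P := od) (M := Set.univ) (U := UII K a R) (L := K + 1)
    (Safe := SafeII K a R)
    (g0 := (fun y => if T.lev y = K + 1 then (resp s y (SII K a R) Set.univ false).1 else
        (resp s y (SII K a R) (CII K a R) true).1))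
    (g1 := (fun y => (resp s y (chS K a R (T.firstU (K + 1) (UII K a R) y))
        (Cone (T.firstU (K + 1) (UII K a R) y)) false).1)) x
    (by
      intro n hn hp
      have hp' : n % 2 = 1 := by
        unfold od at hp
        rwa [x.lev] at hp
      rw [hx n hp', phiII, if_neg (by rw [x.lev]; omega)]
      dsimp only
      rw [x.anc (by omega), ← ha, ← hR])
    (by
      by_cases h : a ∈ SII K a R
      · left
        rw [hsafe _ le_rfl]
        exact ⟨h, fun m h1 h2 => by omega⟩
      · right
        rw [← ha]
        exact ⟨trivial, not_not.1 h⟩)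
    (fun _ _ _ _ => trivial)
    (by
      intro n hn hs hp
      split_ifs with hl
      · apply hsucc n hn hs _ (resp_ch _ _ _ _ _)
        have : n = K + 1 := by rwa [x.lev] at hl
        rw [this, ← ha]
        have h1 := ((hsafe n hn).1 hs).1
        rw [hR] at h1 ⊢
        exact (cii_qc2 s hal h1).2.1
      · apply hsucc n hn hs _ (resp_ch _ _ _ _ _)
        rw [x.lev] at hl
        exact resp_mem s (hvalS n (by omega) hs) (by rw [x.lev]; omega))
    (by
      intro n hn hs hp
      unfold od at hp
      rw [x.lev] at hp
      have hs' := (hsafe n hn).1 hs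
      have h1 : x.1 n ∈ CII K a R := hs'.2 n (by omega) le_rfl
      by_cases h : x.1 (n + 1) ∈ T.Attr od Set.univ (UII K a R)
      · exact Or.inr ⟨trivial, h⟩
      · left
        apply hsucc n hn hs _ (x.ch n)
        exact ((hq2 _ hs'.1 h1).2.2.2 _ h1 (by rw [x.lev]; omega)).2 (by rw [x.lev]; omega) _
          (x.ch n) h)
    (by
      intro n hn hs hU
      have hs' := (hsafe n hn).1 hs
      have hl := hU.1
      rw [x.lev] at hl
      have h1 := hs'.2 n hl le_rfl
      exact (hq2 _ hs'.1 h1).2.1 h1 (attr_hit hU))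
    (by
      intro n hn hs
      rw [hsafe _ (by omega)] at hs ⊢
      exact ⟨hs.1, fun m h1 h2 => hs.2 m h1 (by omega)⟩)
  rcases spec with h | ⟨m, hm, hU, h⟩
  · have haS : a ∈ SII K a R := ((hsafe (K + 1) le_rfl).1 (h _ le_rfl).1).1
    have hC : ∀ m, K + 2 ≤ m → x.1 m ∈ CII K a R := fun m hm =>
      ((hsafe m (by omega)).1 (h m (by omega)).1).2 m hm le_rfl
    refine ⟨mkPlay hK x (SII K a R) (CII K a R) true (by rw [← ha]; exact sii_qi haS) (by simp)
      (fun _ => hq2 _ haS (hC _ le_rfl)) hC, fun n hn => ?_, fun n => rfl⟩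
    change n % 2 = 1 at hn
    apply mkPlay_cons
    · exact hlow n hn
    · omega
    · intro hn1
      have h1 := (h n hn1.ge).2 (by unfold od; rwa [x.lev])
      rw [if_pos (by rwa [x.lev])] at h1
      rw [hn1] at h1 ⊢
      rw [h1, ← ha]
      have h2 := resp_mid s hal (sii_qi haS)
      rw [hR] at h2 haS ⊢
      have h3 := cii_qc2 s hal haS
      exact Prod.ext rfl (Prod.ext h2.1 (Prod.ext rfl h3.1))
    · intro hn2
      have h1 := (h n (by omega)).2 (by unfold od; rwa [x.lev])
      rwa [if_neg (by rw [x.lev]; omega)] at h1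
  · have hm2 : K + 2 ≤ m := by have := hU.1; rwa [x.lev] at this
    have hex := hU.2
    obtain ⟨S, hS⟩ : ∃ S, S = chS K a R (x.1 m) := ⟨_, rfl⟩
    have hch : Chal K a R (x.1 m) S := by
      rw [hS, chS, dif_pos hex]
      exact hex.choose_spec
    obtain ⟨hQ, huS, hx2, hCo, hfl⟩ := hch
    rw [x.anc hm2] at hx2
    have h2 := resp_mid s hal hQ
    rw [← hR] at h2
    have hq1 : QC1 K A (x.1 (K + 2)) S (Cone (x.1 m)) := by
      have := h2.2.1 hfl
      rwa [hx2, hCo] at this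
    rw [ha] at hQ
    have hC : ∀ j, K + 2 ≤ j → x.1 j ∈ Cone (x.1 m) := by
      intro j hj
      rcases Nat.le_total j m with h1 | h1
      · rw [← x.anc h1]; exact anc_mem_cone _ _
      · apply cone_of_anc
        rw [x.lev, x.anc h1]
    refine ⟨mkPlay hK x S (Cone (x.1 m)) false hQ (fun _ => hq1) (by simp) hC,
      fun n hn => ?_, fun n => rfl⟩
    change n % 2 = 1 at hn
    apply mkPlay_cons
    · exact hlow n hn
    · omega
    · intro hn1
      rw [hn1, ← ha, ← hR]
      exact Prod.ext hx2 (Prod.ext h2.1 (Prod.ext hCo hfl))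
    · intro hn2
      rcases Nat.lt_or_ge n m with h1 | h1
      · exact resp_cone s x S m n hn2 h1
          (val_play x S _ false hQ (fun _ => hq1) (by simp) n hn2 (fun j hj _ => hC j hj))
      · obtain ⟨h2, h3⟩ := h n h1
        have := h3 (by unfold od; rwa [x.lev])
        rw [h2, ← hS] at this
        exact this

variable (K A hK) in
/-- The unraveling cover. -/
noncomputable def cover : BCover K T :=
  { T' := utree K A hK
    pr := fun y => UNode.x y
    lev_pr := fun y => rfl
    par_pr := fun y => rfl
    phi := fun b s => if b then ⟨phiI s, phiI_ch s⟩ else ⟨phiII s, phiII_ch s⟩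
    loc := fun b n s t h x hx => by
      cases b
      · exact phiII_loc s t n h x hx
      · exact phiI_loc s t n h x hx
    inj := fun x y hx h => by
      have h1 : T.lev (UNode.x x) ≤ K := hx
      have h2 : UNode.x x = UNode.x y := h
      have h3 : T.lev (UNode.x y) ≤ K := by rw [← h2]; exact h1
      exact UNode.ext' h2 ((x.val.s0 h1).trans (y.val.s0 h3).symm)
        ((x.val.c0 (by omega)).trans (y.val.c0 (by omega)).symm)
        ((x.val.f0 (by omega)).trans (y.val.f0 (by omega)).symm)
    surj := fun x hx => ⟨(⟨x, Set.univ, Set.univ, false, val_low hx⟩ : UNode K A), rfl⟩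
    same := fun b s y hy => by
      have hy' : T.lev (UNode.x y) < K := hy
      have := congrArg Prod.fst (resp_low s y hy'.le)
      cases b
      · change UNode.x (s.1 y) = phiII s (UNode.x y)
        rw [phiII, if_pos hy'.le, this]
        rfl
      · change UNode.x (s.1 y) = phiI s (UNode.x y)
        rw [phiI, if_pos hy'.le, this]
        rfl
    lift := fun b s x hx => by
      cases b
      · exact phiII_lift s x hx
      · exact phiI_lift s x hx }

theorem cover_dec (hA : BOpen Aᶜ) :
    BDec {y : (cover K A hK).T'.Play | (cover K A hK).map y ∈ A} := by
  refine ⟨K + 2, {y | UNode.fl (y : UNode K A) = true}, fun y => ?_⟩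
  have hlev : ∀ n, T.lev (UNode.x (y.1 n)) = n := fun n => y.lev n
  have hch : ∀ n, UCh (K := K) (A := A) (y.1 (n + 1)) (y.1 n) := fun n => uch (hK := hK) (y.ch n)
  have hCf : ∀ n, K + 2 ≤ n → UNode.C (y.1 n) = UNode.C (y.1 (K + 2)) ∧
      UNode.fl (y.1 n) = UNode.fl (y.1 (K + 2)) := by
    intro n hn
    induction n, hn using Nat.le_induction with
    | base => exact ⟨rfl, rfl⟩
    | succ n hn ih =>
      rw [(hch n).C (by rw [hlev]; omega), (hch n).fl (by rw [hlev]; omega)]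
      exact ih
  let x : T.Play := (cover K A hK).map y
  have hx : ∀ n, x.1 n = UNode.x (y.1 n) := fun n => rfl
  have hmem : ∀ n, K + 2 ≤ n → x.1 n ∈ UNode.C (y.1 (K + 2)) := by
    intro n hn
    have := (UNode.val (y.1 n)).c3 n hn (hlev n).ge
    rwa [anc_of_le (hlev n).le, (hCf n hn).1] at this
  change x ∈ A ↔ UNode.fl (y.1 (K + 2)) = true
  constructor
  · intro hxA
    by_contra hfl
    rw [Bool.not_eq_true] at hfl
    obtain ⟨u, -, hul, -, huo, huC⟩ := (UNode.val (y.1 (K + 2))).c1 (hlev _).ge hfl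
    have := hmem (T.lev u) hul
    rw [huC] at this
    have h2 := cone_low this (by rw [x.lev])
    rw [x.lev, anc_self] at h2
    exact huo x h2.symm hxA
  · intro hfl
    by_contra hxA
    obtain ⟨n, hn⟩ := hA x hxA
    obtain ⟨-, -, hno, -⟩ := (UNode.val (y.1 (K + 2))).c2 (hlev _).ge hfl
    apply hno _ (hmem (max n (K + 2)) (by omega))
    intro z hz
    rw [x.lev] at hz
    apply hn z
    rw [← z.anc (le_max_left n (K + 2)), hz, x.anc (le_max_left _ _)]

end BUnr

/-- Closed sets can be unraveled. -/
theorem unravel_closed {T : BTree.{v}} (A : Set T.Play) (hA : BOpen Aᶜ) (k : ℕ) :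
    ∃ c : BCover k T, BDec {y : c.T'.Play | c.map y ∈ A} := by
  refine ⟨(BUnr.cover (2 * k) A (by omega)).weaken (by omega), ?_⟩
  exact BUnr.cover_dec (hK := by omega) hA


/-! ### Borel sets -/

/-- Continuity of maps on plays. -/
def BCont {T : BTree.{v}} {X : Type w} [TopologicalSpace X] (f : T.Play → X) : Prop :=
  ∀ O : Set X, IsOpen O → BOpen (f ⁻¹' O)

theorem BOpen.map {k : ℕ} {T : BTree.{v}} (c : BCover k T) {O : Set T.Play} (h : BOpen O) :
    BOpen (c.map ⁻¹' O) := by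
  intro x hx
  obtain ⟨n, hn⟩ := h _ hx
  exact ⟨n, fun y hy => hn _ (congrArg c.pr hy)⟩

/-- Sets which can be unraveled along all continuous maps. -/
def Unr {X : Type w} [TopologicalSpace X] (B : Set X) : Prop :=
  ∀ (T : BTree.{v}) (f : T.Play → X), BCont f → ∀ k, ∃ c : BCover k T,
    BDec {y : c.T'.Play | f (c.map y) ∈ B}

theorem BDec.compl {T : BTree.{v}} {B : Set T.Play} (h : BDec B) : BDec Bᶜ := by
  obtain ⟨n, D, hD⟩ := h
  exact ⟨n, Dᶜ, fun x => not_congr (hD x)⟩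

section

variable {X : Type w} [TopologicalSpace X]

theorem Unr.compl {B : Set X} (h : Unr.{v} B) : Unr.{v} Bᶜ := by
  intro T f hf k
  obtain ⟨c, hc⟩ := h T f hf k
  exact ⟨c, hc.compl⟩

theorem unr_closed {B : Set X} (h : IsClosed B) : Unr.{v} B := by
  intro T f hf k
  exact unravel_closed (f ⁻¹' B) (hf Bᶜ h.isOpen_compl) k

theorem unr_open {B : Set X} (h : IsOpen B) : Unr.{v} B := by
  have := (unr_closed (B := Bᶜ) h.isClosed_compl).compl
  rwa [compl_compl] at this

variable (X) in
/-- Stages of the construction. -/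
structure BStage where
  T : BTree.{v}
  f : T.Play → X
  cont : BCont f

/-- Next stage. -/
noncomputable def BStage.cov {B : ℕ → Set X} (hB : ∀ i, Unr.{v} (B i)) (k i : ℕ)
    (st : BStage.{v} X) : BCover (k + i) st.T := (hB i st.T st.f st.cont (k + i)).choose

theorem BStage.cov_dec {B : ℕ → Set X} (hB : ∀ i, Unr.{v} (B i)) (k i : ℕ)
    (st : BStage.{v} X) : BDec {y : (st.cov hB k i).T'.Play | st.f ((st.cov hB k i).map y) ∈ B i} :=
  (hB i st.T st.f st.cont (k + i)).choose_spec

/-- Next stage. -/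
noncomputable def BStage.next {B : ℕ → Set X} (hB : ∀ i, Unr.{v} (B i)) (k i : ℕ)
    (st : BStage.{v} X) : BStage.{v} X :=
  { T := (st.cov hB k i).T'
    f := fun y => st.f ((st.cov hB k i).map y)
    cont := fun O hO => (st.cont O hO).map (st.cov hB k i) }

/-- All stages. -/
noncomputable def BStage.seq {B : ℕ → Set X} (hB : ∀ i, Unr.{v} (B i)) (k : ℕ)
    (st : BStage.{v} X) : ℕ → BStage.{v} X
  | 0 => st
  | i + 1 => (BStage.seq hB k st i).next hB k i

/-- The inverse system. -/
noncomputable def BStage.bseq {B : ℕ → Set X} (hB : ∀ i, Unr.{v} (B i)) (k : ℕ)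
    (st : BStage.{v} X) : BSeq.{v} :=
  { k := k
    T := fun i => (BStage.seq hB k st i).T
    pr := fun i => ((BStage.seq hB k st i).cov hB k i).pr
    lev_pr := fun i => ((BStage.seq hB k st i).cov hB k i).lev_pr
    par_pr := fun i => ((BStage.seq hB k st i).cov hB k i).par_pr
    phi := fun i => ((BStage.seq hB k st i).cov hB k i).phi
    loc := fun i => ((BStage.seq hB k st i).cov hB k i).loc
    inj := fun i => ((BStage.seq hB k st i).cov hB k i).inj
    surj := fun i => ((BStage.seq hB k st i).cov hB k i).surj
    same := fun i => ((BStage.seq hB k st i).cov hB k i).same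
    lift := fun i => ((BStage.seq hB k st i).cov hB k i).lift }

theorem Unr.iUnion {B : ℕ → Set X} (hB : ∀ i, Unr.{v} (B i)) : Unr.{v} (⋃ i, B i) := by
  intro T f hf k
  let st : BStage.{v} X := ⟨T, f, hf⟩
  let Q := st.bseq hB k
  let c : BCover k T := Q.limCover
  have hmap : ∀ i (y : Q.lim.Play),
      ((st.seq hB k i).cov hB k i).map (Q.ev (i + 1) y) = Q.ev i y := by
    intro i y
    apply Play.ext'
    intro n
    exact (y.1 n).2 i
  have hev : ∀ i (y : Q.lim.Play), (st.seq hB k i).f (Q.ev i y) = f (c.map y) := by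
    intro i y
    induction i with
    | zero => rfl
    | succ i ih =>
      rw [← ih, ← hmap i y]
      rfl
  have hop : BOpen {y : Q.lim.Play | f (c.map y) ∈ ⋃ i, B i} := by
    intro y hy
    obtain ⟨i, hi⟩ := Set.mem_iUnion.1 hy
    obtain ⟨n, D, hD⟩ := (st.seq hB k i).cov_dec hB k i
    have key : ∀ z : Q.lim.Play, f (c.map z) ∈ B i ↔ (z.1 n).1 (i + 1) ∈ D := by
      intro z
      rw [← hev i z, ← hmap i z]
      exact hD (Q.ev (i + 1) z)
    refine ⟨n, fun z hz => Set.mem_iUnion.2 ⟨i, ?_⟩⟩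
    rw [key, hz, ← key]
    exact hi
  obtain ⟨d, hd⟩ := unravel_closed {y : Q.lim.Play | f (c.map y) ∈ ⋃ i, B i}ᶜ
    (by rwa [compl_compl]) k
  refine ⟨c.comp d, ?_⟩
  have := hd.compl
  obtain ⟨n, D, hD⟩ := this
  refine ⟨n, D, fun x => ?_⟩
  exact Iff.trans not_not.symm (hD x)

theorem unr_borel {B : Set X} (h : @MeasurableSet X (borel X) B) : Unr.{v} B := by
  induction B, h using MeasurableSpace.generateFrom_induction with
  | hC t ht _ => exact unr_open ht
  | empty => exact unr_open isOpen_empty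
  | compl t _ ih => exact ih.compl
  | iUnion s _ ih => exact Unr.iUnion ih

/-- Determinacy from a root. -/
theorem det_root {T : BTree.{v}} (f : T.Play → X) (hf : BCont f) {B : Set X}
    (hB : @MeasurableSet X (borel X) B) (r : T.V) (hr : T.lev r = 0) :
    (∃ s : T.Str, ∀ x : T.Play, x.1 0 = r → Cons true s x → f x ∈ B) ∨
    (∃ s : T.Str, ∀ x : T.Play, x.1 0 = r → Cons false s x → f x ∉ B) := by
  classical
  obtain ⟨c, n, D, hD⟩ := unr_borel hB T f hf 0
  obtain ⟨r', rfl⟩ := c.surj r hr.le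
  let P : c.T'.V → Prop := fun v => c.T'.lev v % 2 = 0
  let U : Set c.T'.V := {v | c.T'.lev v = n ∧ v ∈ D}
  have hlift : ∀ b s (x : T.Play), x.1 0 = c.pr r' → Cons b (c.phi b s) x →
      ∃ y : c.T'.Play, Cons b s y ∧ y.1 0 = r' ∧ (f x ∈ B ↔ y.1 n ∈ D) := by
    intro b s x hx hc
    obtain ⟨y, hy, hyx⟩ := c.lift b s x hc
    refine ⟨y, hy, c.inj _ _ (y.lev 0).le (by rw [hyx, hx]), ?_⟩
    have : c.map y = x := Play.ext' hyx
    rw [← hD y, ← this]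
    rfl
  by_cases hW : r' ∈ c.T'.Attr P Set.univ U
  · left
    refine ⟨c.phi true ⟨c.T'.attrF P Set.univ U, attrF_ch⟩, fun x hx hc => ?_⟩
    obtain ⟨y, hy, hy0, hfx⟩ := hlift _ _ x hx hc
    rw [hfx]
    obtain ⟨m, -, hm⟩ := attr_reach (P := P) (M := Set.univ) (U := U) y 0 (by rwa [hy0]) trivial
      (fun _ _ _ _ => trivial) (fun m _ _ hp => hy m (by
        have : c.T'.lev (y.1 m) % 2 = 0 := hp
        rwa [y.lev] at this))
    have h1 := hm.1
    rw [y.lev] at h1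
    rw [← h1]
    exact hm.2
  · right
    let g : c.T'.V → c.T'.V := fun v =>
      if h : ∃ w, c.T'.Ch w v ∧ w ∉ c.T'.Attr P Set.univ U then h.choose else c.T'.dft v
    have hg : ∀ v, c.T'.Ch (g v) v := by
      intro v
      by_cases h : ∃ w, c.T'.Ch w v ∧ w ∉ c.T'.Attr P Set.univ U
      · simp only [g, dif_pos h]; exact h.choose_spec.1
      · simp only [g, dif_neg h]; exact dft_ch v
    refine ⟨c.phi false ⟨g, hg⟩, fun x hx hc => ?_⟩
    obtain ⟨y, hy, hy0, hfx⟩ := hlift _ _ x hx hc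
    rw [hfx]
    have hout : ∀ m, y.1 m ∉ c.T'.Attr P Set.univ U := by
      intro m
      induction m with
      | zero => rwa [hy0]
      | succ m ih =>
        by_cases hp : m % 2 = 0
        · exact fun h => ih (attr_mine (by change c.T'.lev _ % 2 = 0; rwa [y.lev]) (y.ch m) trivial h)
        · have h : ∃ w, c.T'.Ch w (y.1 m) ∧ w ∉ c.T'.Attr P Set.univ U := by
            by_contra! hno
            exact ih (attr_theirs (by change ¬ c.T'.lev _ % 2 = 0; rwa [y.lev])
              (fun w hw _ => hno w hw))
          rw [hy m (by change m % 2 = 1; omega)]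
          simp only [g, dif_pos h]
          exact h.choose_spec.2
    exact fun h => hout n (attr_hit ⟨y.lev n, h⟩)

end


/-! ### Arbitrary turn order and subgames -/

namespace BDbl

variable {T : BTree.{v}} (own : T.V → Prop) (d : ℕ)

/-- Nodes of the doubled tree. -/
structure DNode where
  t : T.V
  o : Option T.V
  hd : d ≤ T.lev t
  ho : ∀ c, o = some c → (own t → T.Ch c t) ∧ (¬ own t → c = t)

variable {own d}

theorem DNode.ext' {y z : DNode own d} (h1 : y.t = z.t) (h2 : y.o = z.o) : y = z := by
  cases y; cases z; simp_all

open Classical in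
/-- Parent. -/
noncomputable def dpar (y : DNode own d) : DNode own d :=
  if h1 : y.o.isSome then ⟨y.t, none, y.hd, by simp⟩ else
  if h2 : T.lev y.t ≤ d then y else
  { t := T.par y.t
    o := some (if own (T.par y.t) then y.t else T.par y.t)
    hd := by rw [T.lev_par]; omega
    ho := by
      intro c hc
      have hc := Option.some.inj hc
      subst hc
      constructor
      · intro h; rw [if_pos h]; exact ⟨by rw [T.lev_par]; omega, rfl⟩
      · intro h; rw [if_neg h] }

/-- level -/
def dlev (y : DNode own d) : ℕ := 2 * (T.lev y.t - d) + (if y.o.isSome then 1 else 0)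

theorem dlev_dpar (y : DNode own d) : dlev (dpar y) = dlev y - 1 := by
  unfold dpar
  split_ifs with h1 h2
  · simp [dlev, h1]
  · have := y.hd
    simp only [dlev, h1]
    simp
    omega
  all_goals
    simp only [dlev, h1, T.lev_par]
    simp
    omega

theorem dpar_root (y : DNode own d) (h : dlev y = 0) : dpar y = y := by
  unfold dlev at h
  unfold dpar
  split_ifs at h with h1
  · rw [dif_neg h1, dif_pos (by omega)]

theorem dpar_some {y : DNode own d} (h : y.o.isSome) :
    dpar y = ⟨y.t, none, y.hd, by simp⟩ := by
  unfold dpar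
  rw [dif_pos h]

open Classical in
theorem dpar_none {y : DNode own d} (h : ¬ y.o.isSome) (hl : d < T.lev y.t) :
    (dpar y).t = T.par y.t ∧ (dpar y).o = some (if own (T.par y.t) then y.t else T.par y.t) := by
  unfold dpar
  rw [dif_neg h, dif_neg (by omega)]
  exact ⟨rfl, rfl⟩

theorem d_ext (y : DNode own d) : ∃ z : DNode own d, dlev z = dlev y + 1 ∧ dpar z = y := by
  classical
  obtain ⟨t, o, hd, ho⟩ := y
  rcases o with _ | c
  · by_cases h : own t
    · refine ⟨⟨t, some (T.dft t), hd, ?_⟩, ?_, ?_⟩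
      · intro c hc
        have hc := Option.some.inj hc
        subst hc
        exact ⟨fun _ => dft_ch t, fun h' => absurd h h'⟩
      · simp [dlev]
      · rw [dpar_some rfl]
    · refine ⟨⟨t, some t, hd, ?_⟩, ?_, ?_⟩
      · intro c hc
        have hc := Option.some.inj hc
        subst hc
        exact ⟨fun h' => absurd h' h, fun _ => rfl⟩
      · simp [dlev]
      · rw [dpar_some rfl]
  · have key : ∀ c' , T.Ch c' t → (own t → c' = c) →
        ∃ z : DNode own d, dlev z = dlev ⟨t, some c, hd, ho⟩ + 1 ∧ dpar z = ⟨t, some c, hd, ho⟩ := by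
      intro c' hc' h
      have hl := hc'.1
      refine ⟨⟨c', none, by omega, by simp⟩, ?_, ?_⟩
      · simp [dlev]; omega
      · have := dpar_none (own := own) (d := d) (y := ⟨c', none, by omega, by simp⟩) (by simp)
          (by dsimp only; omega)
        dsimp only at this
        rw [hc'.2] at this
        apply DNode.ext' this.1
        rw [this.2]
        dsimp only
        split_ifs with ht
        · rw [h ht]
        · rw [(ho c rfl).2 ht]
    by_cases h : own t
    · exact key c ((ho c rfl).1 h) (fun _ => rfl)
    · exact key (T.dft t) (dft_ch t) (fun h' => absurd h' h)

variable (own d) in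
/-- The doubled tree. -/
noncomputable def dtree : BTree.{v} :=
  { V := DNode own d
    lev := dlev
    par := dpar
    lev_par := dlev_dpar
    par_root := dpar_root
    ext := d_ext }

theorem ch_none {y z : DNode own d} (h : (dtree own d).Ch z y) (hy : y.o = none) :
    z.t = y.t ∧ z.o.isSome := by
  obtain ⟨h1, h2⟩ := h
  change dlev z = dlev y + 1 at h1
  change dpar z = y at h2
  have hz : z.o.isSome := by
    unfold dlev at h1
    rw [hy] at h1
    by_contra hc
    rw [if_neg hc] at h1
    simp at h1
    omega
  refine ⟨?_, hz⟩
  rw [← h2, dpar_some hz]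

theorem ch_some {y z : DNode own d} (h : (dtree own d).Ch z y) {c : T.V} (hy : y.o = some c) :
    z.o = none ∧ T.Ch z.t y.t ∧ (own y.t → z.t = c) := by
  obtain ⟨h1, h2⟩ := h
  change dlev z = dlev y + 1 at h1
  change dpar z = y at h2
  have hz : ¬ z.o.isSome := by
    intro hc
    rw [dpar_some hc] at h2
    rw [← h2] at hy
    simp at hy
  have hl : T.lev z.t = T.lev y.t + 1 := by
    unfold dlev at h1
    rw [hy, if_neg hz] at h1
    simp at h1
    have := y.hd
    omega
  have hyd := y.hd
  obtain ⟨h3, h4⟩ := dpar_none hz (by omega)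
  rw [h2] at h3 h4
  refine ⟨by simpa using hz, ⟨hl, h3.symm⟩, fun ho => ?_⟩
  rw [hy, ← h3, if_pos ho] at h4
  exact (Option.some.inj h4).symm

theorem d_even (y : (dtree own d).Play) (n : ℕ) :
    DNode.o (y.1 (2 * n)) = none ∧ T.lev (DNode.t (y.1 (2 * n))) = d + n := by
  have h : dlev (own := own) (d := d) (y.1 (2 * n)) = 2 * n := y.lev (2 * n)
  generalize y.1 (2 * n) = z at h
  have hz := DNode.hd (own := own) (d := d) z
  unfold dlev at h
  split_ifs at h with h1
  · omega
  · exact ⟨by simpa using h1, by omega⟩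

theorem d_step (y : (dtree own d).Play) (n : ℕ) :
    T.Ch (DNode.t (y.1 (2 * n + 2))) (DNode.t (y.1 (2 * n))) := by
  have h1 := ch_none (y.ch (2 * n)) (d_even y n).1
  obtain ⟨c, hc⟩ := Option.isSome_iff_exists.1 h1.2
  have h2 := ch_some (y.ch (2 * n + 1)) hc
  rw [← h1.1]
  exact h2.2.1

/-- Play of the original tree. -/
noncomputable def toT (y : (dtree own d).Play) : T.Play :=
  ⟨fun n => T.anc n (DNode.t (y.1 (2 * (n - d)))), by rw [lev_anc]; simp, fun n => by
    dsimp only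
    rcases Nat.lt_or_ge n d with h | h
    · rw [show n + 1 - d = 0 by omega, show n - d = 0 by omega]
      exact ch_anc (by rw [(d_even y 0).2]; omega)
    · have h1 := d_step y (n - d)
      have h2 := (d_even y (n - d)).2
      have h3 := (d_even y (n - d + 1)).2
      rw [show n + 1 - d = n - d + 1 by omega, anc_of_le (by omega), anc_of_le (by omega)]
      exact h1⟩

open Classical in
/-- Play of the doubled tree. -/
noncomputable def ofNode (x : T.Play) (n : ℕ) : DNode own d :=
  if n % 2 = 0 then ⟨x.1 (d + n / 2), none, by rw [x.lev]; omega, by simp⟩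
  else ⟨x.1 (d + n / 2), some (if own (x.1 (d + n / 2)) then x.1 (d + n / 2 + 1) else
    x.1 (d + n / 2)), by rw [x.lev]; omega, fun c hc => by
      have hc := Option.some.inj hc
      subst hc
      exact ⟨fun h => by rw [if_pos h]; exact x.ch _, fun h => by rw [if_neg h]⟩⟩

theorem ofNode_t (x : T.Play) (n : ℕ) : (ofNode (own := own) (d := d) x n).t = x.1 (d + n / 2) := by
  unfold ofNode
  split_ifs <;> rfl

theorem ofNode_even (x : T.Play) (n : ℕ) (h : n % 2 = 0) :
    (ofNode (own := own) (d := d) x n).o = none := by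
  unfold ofNode
  rw [if_pos h]

open Classical in
theorem ofNode_odd (x : T.Play) (n : ℕ) (h : ¬ n % 2 = 0) :
    (ofNode (own := own) (d := d) x n).o =
      some (if own (x.1 (d + n / 2)) then x.1 (d + n / 2 + 1) else x.1 (d + n / 2)) := by
  unfold ofNode
  rw [if_neg h]

/-- Play of the doubled tree. -/
noncomputable def ofT (x : T.Play) : (dtree own d).Play :=
  ⟨fun n => ofNode x n, by
      change dlev (own := own) (d := d) _ = 0
      rw [dlev, ofNode_t, ofNode_even _ _ rfl, x.lev]
      simp, fun n => by
      refine ⟨?_, ?_⟩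
      · change dlev (own := own) (d := d) _ = dlev (own := own) (d := d) _ + 1
        rw [dlev, dlev, ofNode_t, ofNode_t, x.lev, x.lev]
        by_cases h : n % 2 = 0
        · rw [ofNode_even _ _ h, ofNode_odd _ _ (by omega)]
          simp
          omega
        · rw [ofNode_even _ _ (by omega), ofNode_odd _ _ h]
          simp
          omega
      · change dpar (own := own) (d := d) _ = _
        by_cases h : n % 2 = 0
        · rw [dpar_some (by rw [ofNode_odd _ _ (by omega)]; rfl)]
          apply DNode.ext'
          · rw [ofNode_t]
            dsimp only
            rw [ofNode_t, show d + (n + 1) / 2 = d + n / 2 by omega]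
          · rw [ofNode_even _ _ h]
        · obtain ⟨h1, h2⟩ := dpar_none (own := own) (d := d) (y := ofNode x (n + 1))
            (by rw [ofNode_even _ _ (by omega)]; simp) (by rw [ofNode_t, x.lev]; omega)
          have e : d + (n + 1) / 2 = d + n / 2 + 1 := by omega
          rw [ofNode_t, e, (x.ch _).2] at h1 h2
          apply DNode.ext'
          · rw [ofNode_t, h1]
          · rw [h2, ofNode_odd _ _ h]⟩

theorem toT_ofT (x : T.Play) : toT (own := own) (d := d) (ofT x) = x := by
  apply Play.ext'
  intro n
  change T.anc n (ofNode (own := own) (d := d) x (2 * (n - d))).t = x.1 n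
  rw [ofNode_t]
  exact x.anc (by omega)

end BDbl

open BDbl in
/-- Determinacy from an arbitrary vertex, for arbitrary turn orders. -/
theorem det_node {X : Type w} [TopologicalSpace X] {T : BTree.{v}} (f : T.Play → X)
    (hf : BCont f) {B : Set X} (hB : @MeasurableSet X (borel X) B) (own : T.V → Prop) (s0 : T.V) :
    (∃ g : T.Str, ∀ x : T.Play, x.1 (T.lev s0) = s0 →
      (∀ n, T.lev s0 ≤ n → own (x.1 n) → x.1 (n + 1) = g.1 (x.1 n)) → f x ∈ B) ∨
    (∃ g : T.Str, ∀ x : T.Play, x.1 (T.lev s0) = s0 →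
      (∀ n, T.lev s0 ≤ n → ¬ own (x.1 n) → x.1 (n + 1) = g.1 (x.1 n)) → f x ∉ B) := by
  classical
  obtain ⟨d, hd⟩ : ∃ d, d = T.lev s0 := ⟨_, rfl⟩
  rw [← hd]
  have hcont : BCont (fun y : (dtree own d).Play => f (toT y)) := by
    intro O hO y hy
    obtain ⟨n, hn⟩ := hf O hO _ hy
    refine ⟨2 * (n - d), fun z hz => hn _ ?_⟩
    change T.anc n _ = T.anc n _
    rw [hz]
  let r : DNode own d := ⟨s0, none, hd.le, by simp⟩
  have hroot : ∀ x : T.Play, x.1 d = s0 → (ofT (own := own) (d := d) x).1 0 = r := by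
    intro x hx
    apply DNode.ext'
    · change (ofNode x 0).t = s0
      rw [ofNode_t]
      exact hx
    · exact ofNode_even x 0 rfl
  rcases det_root (fun y : (dtree own d).Play => f (toT y)) hcont hB r
      (by change dlev r = 0; simp [dlev, r, hd]) with ⟨s, hs⟩ | ⟨s, hs⟩
  · left
    let nd : ∀ v : T.V, d ≤ T.lev v → DNode own d := fun v h => ⟨v, none, h, by simp⟩
    let g : T.V → T.V := fun v =>
      if h : d ≤ T.lev v ∧ own v then
        (DNode.o (s.1 (nd v h.1))).getD v
      else T.dft v
    have hg1 : ∀ v (h : d ≤ T.lev v), own v → DNode.o (s.1 (nd v h)) = some (g v) := by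
      intro v h1 h2
      have := ch_none (s.2 (nd v h1)) rfl
      obtain ⟨c, hc⟩ := Option.isSome_iff_exists.1 this.2
      simp only [g]
      rw [dif_pos ⟨h1, h2⟩, hc]
      rfl
    have hg : ∀ v, T.Ch (g v) v := by
      intro v
      by_cases h : d ≤ T.lev v ∧ own v
      · have h1 := hg1 v h.1 h.2
        have h2 := (ch_none (s.2 (nd v h.1)) rfl).1
        have h3 := (DNode.ho (s.1 (nd v h.1)) _ h1).1
        rw [h2] at h3
        exact h3 h.2
      · simp only [g, dif_neg h]; exact dft_ch v
    refine ⟨⟨g, hg⟩, fun x hx hcons => ?_⟩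
    have := hs (ofT x) (hroot x hx) ?_
    · rwa [toT_ofT] at this
    · intro n hn
      change n % 2 = 0 at hn
      change ofNode x (n + 1) = s.1 (ofNode x n)
      have hl : d ≤ T.lev (x.1 (d + n / 2)) := by rw [x.lev]; omega
      have e1 : ofNode (own := own) (d := d) x n = nd (x.1 (d + n / 2)) hl :=
        DNode.ext' (ofNode_t x n) (ofNode_even x n hn)
      rw [e1]
      have h1 := ch_none (s.2 (nd _ hl)) rfl
      have e2 : d + (n + 1) / 2 = d + n / 2 := by omega
      apply DNode.ext'
      · rw [h1.1, ofNode_t, e2]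
      · rw [ofNode_odd _ _ (by omega), e2]
        obtain ⟨c, hc⟩ := Option.isSome_iff_exists.1 h1.2
        have h2 := DNode.ho (s.1 (nd _ hl)) _ hc
        rw [h1.1] at h2
        split_ifs with ho
        · rw [hg1 _ hl ho]
          exact congrArg some (hcons _ (by omega) ho)
        · rw [hc]
          exact congrArg some (h2.2 ho).symm
  · right
    let nd : ∀ v : T.V, d ≤ T.lev v → ¬ own v → DNode own d := fun v h h' => ⟨v, some v, h, by
      intro c hc
      have hc := Option.some.inj hc
      subst hc
      exact ⟨fun h => absurd h h', fun _ => rfl⟩⟩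
    let g : T.V → T.V := fun v =>
      if h : d ≤ T.lev v ∧ ¬ own v then DNode.t (s.1 (nd v h.1 h.2)) else T.dft v
    have hg : ∀ v, T.Ch (g v) v := by
      intro v
      by_cases h : d ≤ T.lev v ∧ ¬ own v
      · simp only [g, dif_pos h]
        exact (ch_some (s.2 (nd v h.1 h.2)) rfl).2.1
      · simp only [g, dif_neg h]; exact dft_ch v
    refine ⟨⟨g, hg⟩, fun x hx hcons => ?_⟩
    have := hs (ofT x) (hroot x hx) ?_
    · rwa [toT_ofT] at this
    · intro n hn
      change n % 2 = 1 at hn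
      change ofNode x (n + 1) = s.1 (ofNode x n)
      have hl : d ≤ T.lev (x.1 (d + n / 2)) := by rw [x.lev]; omega
      have h1 := ch_some (s.2 (ofNode (own := own) (d := d) x n)) (ofNode_odd x n (by omega))
      have e2 : d + (n + 1) / 2 = d + n / 2 + 1 := by omega
      apply DNode.ext'
      · rw [ofNode_t, e2]
        by_cases ho : own (x.1 (d + n / 2))
        · have := h1.2.2 (by rwa [ofNode_t])
          rw [if_pos ho] at this
          exact this.symm
        · have e1 : ofNode (own := own) (d := d) x n = nd (x.1 (d + n / 2)) hl ho :=
            DNode.ext' (ofNode_t x n) (by rw [ofNode_odd x n (by omega), if_neg ho])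
          rw [hcons _ (by omega) ho, e1]
          simp only [g]
          rw [dif_pos ⟨hl, ho⟩]
      · rw [h1.1, ofNode_even _ _ (by omega)]


/-! ### Nash equilibria -/

namespace BNash

variable {T : BTree.{v}} {N : Type w}

/-- Existence of plays through a vertex. -/
theorem play_from (g : T.Str) (s : T.V) : ∃ x : T.Play, x.1 (T.lev s) = s ∧
    ∀ n, T.lev s ≤ n → x.1 (n + 1) = g.1 (x.1 n) := by
  have hit : ∀ k, T.lev (g.1^[k] s) = T.lev s + k := by
    intro k
    induction k with
    | zero => rfl
    | succ k ih => rw [Function.iterate_succ_apply', (g.2 _).1, ih]; omega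
  let x : ℕ → T.V := fun n => T.anc n (g.1^[n - T.lev s] s)
  have hx : ∀ n, T.lev s ≤ n → x n = g.1^[n - T.lev s] s := by
    intro n hn
    exact anc_of_le (by rw [hit]; omega)
  have hx2 : ∀ n, T.lev s ≤ n → x (n + 1) = g.1 (x n) := by
    intro n hn
    rw [hx n hn, hx (n + 1) (by omega), show n + 1 - T.lev s = (n - T.lev s) + 1 by omega,
      Function.iterate_succ_apply']
  refine ⟨⟨x, ?_, fun n => ?_⟩, ?_, hx2⟩
  · change T.lev (T.anc 0 _) = 0
    rw [lev_anc]; simp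
  · rcases Nat.lt_or_ge n (T.lev s) with h | h
    · change T.Ch (T.anc (n + 1) _) (T.anc n _)
      rw [show n + 1 - T.lev s = 0 by omega, show n - T.lev s = 0 by omega]
      exact ch_anc h
    · rw [hx2 n h]
      exact g.2 _
  · change x (T.lev s) = s
    rw [hx _ le_rfl]
    simp

/-- `g` guarantees `c` to player `i` from `s`. -/
def Guar (ctrl : T.V → N) (u : N → T.Play → ℕ) (i : N) (s : T.V) (g : T.Str) (c : ℕ) : Prop :=
  ∀ x : T.Play, x.1 (T.lev s) = s →
    (∀ n, T.lev s ≤ n → ctrl (x.1 n) = i → x.1 (n + 1) = g.1 (x.1 n)) → c ≤ u i x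

/-- `g` punishes player `i` from `s`. -/
def Pun (ctrl : T.V → N) (u : N → T.Play → ℕ) (i : N) (s : T.V) (g : T.Str) (c : ℕ) : Prop :=
  ∀ x : T.Play, x.1 (T.lev s) = s →
    (∀ n, T.lev s ≤ n → ctrl (x.1 n) ≠ i → x.1 (n + 1) = g.1 (x.1 n)) → u i x ≤ c

theorem exists_val (ctrl : T.V → N) (u : N → T.Play → ℕ) (M : ℕ) (hM : ∀ i x, u i x ≤ M)
    (hdet : ∀ i s c, (∃ g, Guar ctrl u i s g (c + 1)) ∨ (∃ g, Pun ctrl u i s g c))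
    (i : N) (s : T.V) : ∃ c, ∃ g h : T.Str, Guar ctrl u i s g c ∧ Pun ctrl u i s h c ∧ c ≤ M ∧
      ∀ g' c', Guar ctrl u i s g' c' → c' ≤ c := by
  classical
  have hle : ∀ g c, Guar ctrl u i s g c → c ≤ M := by
    intro g c hg
    obtain ⟨x, hx, hx2⟩ := play_from g s
    exact (hg x hx (fun n hn _ => hx2 n hn)).trans (hM i x)
  let W : ℕ → Prop := fun c => ∃ g, Guar ctrl u i s g c
  have h0 : W 0 := ⟨⟨T.dft, dft_ch⟩, fun _ _ _ => Nat.zero_le _⟩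
  have hb : ∃ c, W c ∧ ∀ c', W c' → c' ≤ c := by
    refine ⟨Nat.findGreatest W M, Nat.findGreatest_spec (Nat.zero_le _) h0, fun c' hc' => ?_⟩
    obtain ⟨g, hg⟩ := hc'
    exact Nat.le_findGreatest (hle g c' hg) ⟨g, hg⟩
  obtain ⟨c, ⟨g, hg⟩, hmax⟩ := hb
  rcases hdet i s c with h | ⟨h, hh⟩
  · have := hmax _ h
    omega
  · exact ⟨c, g, h, hg, hh, hle g c hg, fun g' c' hg' => hmax c' ⟨g', hg'⟩⟩

theorem exists_nash (ctrl : T.V → N) (u : N → T.Play → ℕ) (M : ℕ) (hM : ∀ i x, u i x ≤ M)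
    (hdet : ∀ i s c, (∃ g, Guar ctrl u i s g (c + 1)) ∨ (∃ g, Pun ctrl u i s g c))
    (r : T.V) (hr : T.lev r = 0) :
    ∃ ψ : T.Str, ∃ p : T.Play, p.1 0 = r ∧ (∀ n, p.1 (n + 1) = ψ.1 (p.1 n)) ∧
      ∀ i (y : T.Play), y.1 0 = r → (∀ n, ctrl (y.1 n) ≠ i → y.1 (n + 1) = ψ.1 (y.1 n)) →
        u i y ≤ u i p := by
  classical
  choose val opt pun hopt hpun hvM hmax using exists_val ctrl u M hM hdet
  let step : T.V × (N → T.Str) → T.V × (N → T.Str) := fun q =>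
    let s' := (q.2 (ctrl q.1)).1 q.1
    (s', fun j => if val j s' = val j q.1 then q.2 j else opt j s')
  let st : ℕ → T.V × (N → T.Str) := fun n => step^[n] (r, fun j => opt j r)
  have hst : ∀ n, st (n + 1) = step (st n) := fun n => Function.iterate_succ_apply' _ _ _
  let p : T.Play := ⟨fun n => (st n).1, hr, fun n => by
    dsimp only
    rw [hst]
    exact ((st n).2 (ctrl (st n).1)).2 _⟩
  have hp : ∀ n, (st n).1 = p.1 n := fun n => rfl
  have hp1 : ∀ n, p.1 (n + 1) = ((st n).2 (ctrl (p.1 n))).1 (p.1 n) := by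
    intro n
    rw [← hp, hst, ← hp]
  have hg1 : ∀ n j, (st (n + 1)).2 j =
      if val j (p.1 (n + 1)) = val j (p.1 n) then (st n).2 j else opt j (p.1 (n + 1)) := by
    intro n j
    rw [hp1 n, hst, ← hp]
  have hpass : ∀ n j, Guar ctrl u j (p.1 n) ((st n).2 j) (val j (p.1 n)) →
      Guar ctrl u j (p.1 (n + 1)) ((st n).2 j) (val j (p.1 n)) := by
    intro n j h x hx hc
    rw [p.lev] at hx hc
    have e : x.1 n = p.1 n := by
      rw [← x.anc (Nat.le_succ n), hx, p.anc (Nat.le_succ n)]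
    apply h x
    · rwa [p.lev]
    · intro k hk hj
      rw [p.lev] at hk
      rcases Nat.eq_or_lt_of_le hk with h1 | h1
      · subst h1
        rw [e] at hj ⊢
        rw [hx, hp1, hj]
      · exact hc k h1 hj
  have hinv : ∀ n j, Guar ctrl u j (p.1 n) ((st n).2 j) (val j (p.1 n)) := by
    intro n
    induction n with
    | zero => intro j; exact hopt j r
    | succ n ih =>
      intro j
      rw [hg1]
      split_ifs with h
      · rw [h]
        exact hpass n j (ih j)
      · exact hopt j _
  have hmono : ∀ j, Monotone fun n => val j (p.1 n) := fun j =>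
    monotone_nat_of_le_succ fun n => hmax j _ _ _ (hpass n j (hinv n j))
  have hval : ∀ j n, val j (p.1 n) ≤ u j p := by
    intro j n
    obtain ⟨b, n0, hb⟩ := converges_of_monotone_of_bounded (hmono j) (fun n => hvM j _)
    have hconst : ∀ k, n0 ≤ k → (st k).2 j = (st n0).2 j := by
      intro k hk
      induction k, hk using Nat.le_induction with
      | base => rfl
      | succ k hk ih =>
        rw [hg1, if_pos (by rw [hb k hk, hb (k + 1) (by omega)]), ih]
    have h1 : val j (p.1 n0) ≤ u j p := by
      apply hinv n0 j p
      · rw [p.lev]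
      · intro k hk hj
        rw [p.lev] at hk
        rw [hp1, hj, hconst k hk]
    calc val j (p.1 n) ≤ val j (p.1 (max n n0)) := hmono j (le_max_left _ _)
      _ = val j (p.1 n0) := by rw [hb _ (le_max_right _ _), hb _ le_rfl]
      _ ≤ u j p := h1
  -- the profile
  let dev : T.V → Prop := fun v => ∃ m, T.anc m v ≠ p.1 m ∧ m ≤ T.lev v
  let ψ : T.V → T.V := fun v =>
    if h : dev v then
      (pun (ctrl (p.1 (Nat.find h - 1))) (p.1 (Nat.find h - 1))).1 v
    else if v = p.1 (T.lev v) then p.1 (T.lev v + 1) else T.dft v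
  have hψ : ∀ v, T.Ch (ψ v) v := by
    intro v
    simp only [ψ]
    split_ifs with h1 h2
    · exact (pun _ _).2 v
    · have := p.ch (T.lev v)
      rwa [← h2] at this
    · exact dft_ch v
  have hnd : ∀ n, ¬ dev (p.1 n) := by
    rintro n ⟨m, h1, h2⟩
    rw [p.lev] at h2
    exact h1 (p.anc h2)
  have hψp : ∀ n, ψ (p.1 n) = p.1 (n + 1) := by
    intro n
    simp only [ψ]
    rw [dif_neg (hnd n), p.lev, if_pos rfl]
  refine ⟨⟨ψ, hψ⟩, p, rfl, fun n => (hψp n).symm, fun i y hy0 hy => ?_⟩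
  by_cases hyp : ∃ m, y.1 m ≠ p.1 m
  · have hf := Nat.find_spec hyp
    have hmin : ∀ k, k < Nat.find hyp → y.1 k = p.1 k := fun k hk => not_not.1 (Nat.find_min hyp hk)
    generalize Nat.find hyp = m at hf hmin
    have hm0 : m ≠ 0 := by
      rintro rfl
      exact hf hy0
    obtain ⟨k, rfl⟩ := Nat.exists_eq_succ_of_ne_zero hm0
    rw [Nat.succ_eq_add_one] at hf hmin
    have hk := hmin k (by omega)
    have hci : ctrl (p.1 k) = i := by
      by_contra hc
      apply hf
      rw [hy k (by rwa [hk]), hk]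
      exact hψp k
    have hψy : ∀ n, k + 1 ≤ n → ψ (y.1 n) = (pun i (p.1 k)).1 (y.1 n) := by
      intro n hn
      have hd : dev (y.1 n) := ⟨k + 1, by rwa [y.anc hn], by rwa [y.lev]⟩
      have hfind : Nat.find hd = k + 1 := by
        rw [Nat.find_eq_iff]
        refine ⟨⟨by rwa [y.anc hn], by rwa [y.lev]⟩, ?_⟩
        rintro j hj ⟨h1, h2⟩
        rw [y.anc (by omega)] at h1
        exact h1 (hmin j hj)
      simp only [ψ]
      rw [dif_pos hd, hfind, Nat.add_sub_cancel, hci]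
    refine le_trans (hpun i (p.1 k) y ?_ ?_) (hval i k)
    · rw [p.lev, hk]
    · intro n hn hc
      rw [p.lev] at hn
      rcases Nat.eq_or_lt_of_le hn with h1 | h1
      · subst h1
        rw [hk] at hc
        exact absurd hci hc
      · rw [hy n hc]
        exact hψy n h1
  · push Not at hyp
    rw [Play.ext' hyp]

end BNash



namespace DGame

variable {N S A : Type*} (G : DGame N S A)

/-- Edges. -/
def Edge (s t : S) : Prop := ∃ a ∈ G.act s, t = G.succ s a

/-- Depth relation. -/
def Dep : ℕ → S → Prop
  | 0, z => z = G.init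
  | n + 1, z => ∃ y, Dep n y ∧ G.Edge y z

variable {G}

theorem edge_inj {y y' z : S} (h : G.Edge y z) (h' : G.Edge y' z) : y = y' := by
  obtain ⟨a, ha, rfl⟩ := h
  obtain ⟨a', ha', e⟩ := h'
  exact (G.unique_pred _ _ _ _ ha ha' e).1

theorem not_edge_init {y : S} : ¬ G.Edge y G.init := by
  rintro ⟨a, ha, e⟩
  exact G.init_not_succ _ _ ha e.symm

theorem dep_unique {n m : ℕ} {z : S} (h : G.Dep n z) (h' : G.Dep m z) : n = m := by
  induction n generalizing m z with
  | zero =>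
    cases m with
    | zero => rfl
    | succ m =>
      obtain ⟨y, -, hy⟩ := h'
      rw [show z = G.init from h] at hy
      exact absurd hy not_edge_init
  | succ n ih =>
    obtain ⟨y, hy1, hy⟩ := h
    cases m with
    | zero =>
      rw [show z = G.init from h'] at hy
      exact absurd hy not_edge_init
    | succ m =>
      obtain ⟨y', hy1', hy'⟩ := h'
      have := edge_inj hy hy'
      subst this
      rw [ih hy1 hy1']

theorem exists_dep (z : S) : ∃ n, G.Dep n z := by
  have h := G.reach z
  induction h with
  | refl => exact ⟨0, rfl⟩
  | tail _ hbc ih =>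
    obtain ⟨n, hn⟩ := ih
    exact ⟨n + 1, _, hn, hbc⟩

variable (G) in
/-- Depth. -/
noncomputable def depth (z : S) : ℕ := (G.exists_dep z).choose

theorem dep_depth (z : S) : G.Dep (G.depth z) z := (G.exists_dep z).choose_spec

theorem depth_init : G.depth G.init = 0 := dep_unique (dep_depth _) rfl

theorem depth_edge {y z : S} (h : G.Edge y z) : G.depth z = G.depth y + 1 :=
  dep_unique (dep_depth z) ⟨y, dep_depth y, h⟩

theorem eq_init {z : S} (h : G.depth z = 0) : z = G.init := by
  have := G.dep_depth z
  rw [h] at this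
  exact this

theorem exists_pred {z : S} (h : G.depth z ≠ 0) : ∃ y, G.Edge y z := by
  obtain ⟨n, hn⟩ := Nat.exists_eq_succ_of_ne_zero h
  have := G.dep_depth z
  rw [hn] at this
  obtain ⟨y, -, hy⟩ := this
  exact ⟨y, hy⟩

open Classical in
variable (G) in
/-- Predecessor. -/
noncomputable def pred (z : S) : S := if h : ∃ y, G.Edge y z then h.choose else z

theorem pred_edge {y z : S} (h : G.Edge y z) : G.pred z = y := by
  have hex : ∃ y, G.Edge y z := ⟨y, h⟩
  rw [pred, dif_pos hex]
  exact edge_inj hex.choose_spec h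

theorem pred_init : G.pred G.init = G.init := by
  rw [pred, dif_neg]
  rintro ⟨y, hy⟩
  exact not_edge_init hy

theorem exists_edge (s : S) : ∃ t, G.Edge s t := by
  obtain ⟨a, ha⟩ := G.act_nonempty s
  exact ⟨_, a, ha, rfl⟩

variable (G) in
/-- The game tree. -/
noncomputable def tree : BTree :=
  { V := S
    lev := G.depth
    par := G.pred
    lev_par := fun z => by
      by_cases h : G.depth z = 0
      · rw [eq_init h, pred_init, depth_init]
      · obtain ⟨y, hy⟩ := exists_pred h
        rw [pred_edge hy, depth_edge hy]
        rfl
    par_root := fun z h => by rw [eq_init h, pred_init]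
    ext := fun z => by
      obtain ⟨t, ht⟩ := G.exists_edge z
      exact ⟨t, depth_edge ht, pred_edge ht⟩ }

theorem tree_ch {y z : S} : G.tree.Ch z y ↔ G.Edge y z := by
  constructor
  · rintro ⟨h1, h2⟩
    change G.depth z = G.depth y + 1 at h1
    change G.pred z = y at h2
    obtain ⟨y', hy'⟩ := exists_pred (G := G) (z := z) (by omega)
    rw [pred_edge hy'] at h2
    rwa [← h2]
  · exact fun h => ⟨depth_edge h, pred_edge h⟩

open Classical in
variable (G) in
/-- Action along an edge. -/
noncomputable def ac (y z : S) : A :=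
  if h : G.Edge y z then h.choose else (G.act_nonempty y).some

theorem ac_mem (y z : S) : G.ac y z ∈ G.act y := by
  unfold ac
  split_ifs with h
  · exact h.choose_spec.1
  · exact (G.act_nonempty y).some_mem

theorem succ_ac {y z : S} (h : G.Edge y z) : G.succ y (G.ac y z) = z := by
  rw [ac, dif_pos h]
  exact h.choose_spec.2.symm

theorem ac_succ {y : S} {a : A} (ha : a ∈ G.act y) : G.ac y (G.succ y a) = a := by
  have h : G.Edge y (G.succ y a) := ⟨a, ha, rfl⟩
  exact (G.unique_pred _ _ _ _ (ac_mem y _) ha (succ_ac h)).2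

variable (G) in
/-- From branches to plays. -/
noncomputable def toPlay (x : G.tree.Play) : G.Play :=
  ⟨fun n => (x.1 n, G.ac (x.1 n) (x.1 (n + 1))), eq_init x.2.1, fun m =>
    ⟨ac_mem _ _, (succ_ac (tree_ch.1 (x.ch m))).symm⟩⟩

theorem toPlay_cont : BCont G.toPlay := by
  intro O hO x hx
  letI : TopologicalSpace S := ⊥
  letI : TopologicalSpace A := ⊥
  obtain ⟨O', hO', rfl⟩ := isOpen_induced_iff.1 hO
  obtain ⟨I, U, hU, hsub⟩ := isOpen_pi_iff.1 hO' _ hx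
  refine ⟨I.sup id + 1, fun y hy => hsub ?_⟩
  intro k hk
  have hk' : k ≤ I.sup id := Finset.le_sup (f := id) hk
  have e : ∀ j, j ≤ I.sup id + 1 → y.1 j = x.1 j := by
    intro j hj
    rw [← y.anc hj, hy, x.anc hj]
  have : (G.toPlay y).1 k = (G.toPlay x).1 k := by
    change (y.1 k, G.ac (y.1 k) (y.1 (k + 1))) = (x.1 k, G.ac (x.1 k) (x.1 (k + 1)))
    rw [e k (by omega), e (k + 1) (by omega)]
  rw [this]
  exact (hU k hk).2

variable (G) in
/-- The branch of a profile. -/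
noncomputable def branch (σ : G.Profile) : G.tree.Play :=
  ⟨fun n => G.stSeq σ n, depth_init, fun n => tree_ch.2
    ⟨_, (σ (G.ctrl (G.stSeq σ n))).2 (G.stSeq σ n) rfl, rfl⟩⟩

theorem toPlay_branch (σ : G.Profile) : G.toPlay (G.branch σ) = G.playOf σ := by
  apply Subtype.ext
  funext n
  refine Prod.ext rfl ?_
  exact ac_succ ((σ (G.ctrl (G.stSeq σ n))).2 (G.stSeq σ n) rfl)

end DGame

theorem exists_secure_equilibrium_deterministic
    {N S A : Type*} [Finite N]
    (hN : 2 ≤ Nat.card N)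
    (G : DGame N S A) (u : N → G.Play → ℝ)
    (hu_meas : ∀ i : N, Measurable (u i))
    (hu_fin : ∀ i : N, (Set.range (u i)).Finite) :
    ∃ σ : G.Profile, G.IsSecure u σ := by
  classical
  cases nonempty_fintype N
  let Q : G.Play → (N → ℝ) := fun q i => u i q
  have hQm : Measurable Q := measurable_pi_iff.2 hu_meas
  have hQf : (Set.range Q).Finite := by
    refine (Set.Finite.pi' hu_fin).subset ?_
    rintro _ ⟨q, rfl⟩ i
    exact ⟨q, rfl⟩
  have hmeas : ∀ P : (N → ℝ) → Prop, MeasurableSet {q | P (Q q)} := by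
    intro P
    have : {q | P (Q q)} = Q ⁻¹' {z | z ∈ Set.range Q ∧ P z} := by
      ext q
      simp
    rw [this]
    exact hQm (hQf.subset (fun z hz => hz.1)).measurableSet
  let L : N → (N → ℝ) → ℝ ×ₗ ℝ := fun i z => toLex (z i, - ∑ j, z j)
  let Rk : N → (N → ℝ) → ℕ := fun i z => (L i '' {t ∈ Set.range Q | L i t < L i z}).ncard
  have hfin : ∀ i z, (L i '' {t ∈ Set.range Q | L i t < L i z}).Finite := fun i z =>
    (hQf.subset (fun t ht => ht.1)).image _
  have hRk : ∀ i q q', L i (Q q) < L i (Q q') → Rk i (Q q) < Rk i (Q q') := by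
    intro i q q' h
    apply Set.ncard_lt_ncard _ (hfin _ _)
    refine ⟨?_, fun hsub => ?_⟩
    · rintro _ ⟨t, ht, rfl⟩
      exact ⟨t, ⟨ht.1, ht.2.trans h⟩, rfl⟩
    · obtain ⟨t, ht, e⟩ := hsub ⟨Q q, ⟨⟨q, rfl⟩, h⟩, rfl⟩
      exact absurd (e ▸ ht.2) (lt_irrefl _)
  have hbound : ∀ i z, Rk i z ≤ (Set.range Q).ncard := by
    intro i z
    refine (Set.ncard_image_le (hQf.subset (fun t ht => ht.1))).trans ?_
    exact Set.ncard_le_ncard (fun t ht => ht.1) hQf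
  let w : N → G.tree.Play → ℕ := fun i x => Rk i (Q (G.toPlay x))
  have hdet : ∀ i s c, (∃ g, BNash.Guar (T := G.tree) G.ctrl w i s g (c + 1)) ∨
      (∃ g, BNash.Pun (T := G.tree) G.ctrl w i s g c) := by
    intro i s c
    rcases det_node G.toPlay DGame.toPlay_cont (hmeas (fun z => c + 1 ≤ Rk i z))
      (fun v => G.ctrl v = i) s with ⟨g, hg⟩ | ⟨g, hg⟩
    · exact Or.inl ⟨g, hg⟩
    · right
      refine ⟨g, fun x hx hc => ?_⟩
      have : ¬ (c + 1 ≤ Rk i (Q (G.toPlay x))) := hg x hx hc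
      change Rk i (Q (G.toPlay x)) ≤ c
      omega
  obtain ⟨ψ, p, hp0, hp, hnash⟩ := BNash.exists_nash (T := G.tree) G.ctrl w _
    (fun i x => hbound i _) hdet G.init DGame.depth_init
  have hE : ∀ s, G.Edge s (ψ.1 s) := fun s => DGame.tree_ch.1 (ψ.2 s)
  let σ : G.Profile := fun i => ⟨fun s => G.ac s (ψ.1 s), fun s _ => DGame.ac_mem _ _⟩
  have hσ : ∀ s, G.playFun σ s = G.ac s (ψ.1 s) := fun s => rfl
  have hbr : G.branch σ = p := by
    apply Play.ext'
    intro n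
    induction n with
    | zero => exact hp0.symm
    | succ n ih =>
      rw [hp n, ← ih]
      exact DGame.succ_ac (hE _)
  have key : ∀ i (τ : G.Strat i), L i (Q (G.playOf (G.comb i τ σ))) ≤ L i (Q (G.playOf σ)) := by
    intro i τ
    have h1 := hnash i (G.branch (G.comb i τ σ)) rfl (fun n hn => by
      have e : G.playFun (G.comb i τ σ) (G.stSeq (G.comb i τ σ) n) =
          G.ac (G.stSeq (G.comb i τ σ) n) (ψ.1 (G.stSeq (G.comb i τ σ) n)) := by
        have hn' : G.ctrl (G.stSeq (G.comb i τ σ) n) ≠ i := hn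
        generalize G.stSeq (G.comb i τ σ) n = s at hn'
        rw [← hσ]
        have e2 : G.comb i τ σ (G.ctrl s) = σ (G.ctrl s) := by
          unfold DGame.comb
          exact Function.update_of_ne (β := fun j => G.Strat j) hn' τ σ
        unfold DGame.playFun
        rw [e2]
      change G.succ _ (G.playFun (G.comb i τ σ) (G.stSeq (G.comb i τ σ) n)) = _
      rw [e]
      exact DGame.succ_ac (hE _))
    rw [← hbr] at h1
    simp only [w] at h1
    rw [DGame.toPlay_branch, DGame.toPlay_branch] at h1
    by_contra hc
    exact absurd (hRk i _ _ (not_le.1 hc)) (not_lt.2 h1)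
  refine ⟨σ, fun i τ => ?_, ?_⟩
  · have := key i τ
    rw [Prod.Lex.le_iff] at this
    rcases this with h | ⟨h, -⟩
    · exact le_of_lt h
    · exact le_of_eq h
  · rintro ⟨i, τ, h1, h2, k, hk, h3⟩
    have := key i τ
    rw [Prod.Lex.le_iff] at this
    have hsum : ∑ j, u j (G.playOf (G.comb i τ σ)) < ∑ j, u j (G.playOf σ) := by
      apply Finset.sum_lt_sum
      · intro j _
        by_cases hj : j = i
        · rw [hj]; exact le_of_eq h1
        · exact h2 j hj
      · exact ⟨k, Finset.mem_univ _, h3⟩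
    rcases this with h | ⟨-, h⟩
    · exact absurd h1 (ne_of_lt h)
    · have h' : - ∑ j, u j (G.playOf (G.comb i τ σ)) ≤ - ∑ j, u j (G.playOf σ) := h
      linarith
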